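/- arXiv:2510.11252 — 3 statements merged into one kernel-verified Lean document; each statement's English description precedes it below -/
import Mathlib

section
/- Let N ≥ 2 be an integer and suppose (x_1, m_1) and (x_2, m_2) are two N-solutions with x_1 < x_2 and x_2 ≥ 100001. Then log N / log(1.5·e·(1 + log N/ log 100001)) < 1.69019×10^{10} · log x_1 · log(x_2 − 1) · log x_2. -/
/-- For an integer `N ≥ 2`, a pair `(x, m)` with `x ≥ 2`, `m ≥ 2` is an `N`-solution if
`(x^m - 1)/(x - 1) = 1 + x + ⋯ + x^(m-1) = N`. -/
def IsNSol (N x m : ℕ) : Prop :=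
  2 ≤ x ∧ 2 ≤ m ∧ ∑ i ∈ Finset.range m, x ^ i = N

/-- A binomial coefficient bound with a free parameter `y`. -/
theorem choose_le_div_pow_mul_exp (T k : ℕ) {y : ℝ} (hy : 0 < y) :
    (T.choose k : ℝ) ≤ (T / y) ^ k * Real.exp y := by
  have h1 : (T.choose k : ℝ) ≤ (T : ℝ) ^ k / (k.factorial : ℝ) := Nat.choose_le_pow_div k T
  have h2 : y ^ k / (k.factorial : ℝ) ≤ Real.exp y := Real.pow_div_factorial_le_exp y hy.le k
  calc (T.choose k : ℝ) ≤ (T : ℝ) ^ k / (k.factorial : ℝ) := h1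
    _ = (T / y) ^ k * (y ^ k / (k.factorial : ℝ)) := by
        rw [div_pow]; field_simp
    _ ≤ _ := by gcongr

/-- The remainder of the exponential series, bounded with a free parameter `y`. -/
theorem abs_exp_sub_sum_le {z y : ℝ} (hy : 0 < y) (hz : |z| ≤ y) (K : ℕ) :
    |Real.exp z - ∑ i ∈ Finset.range K, z ^ i / (i.factorial : ℝ)|
      ≤ (|z| / y) ^ K * Real.exp y := by
  have hs : ∀ x : ℝ, HasSum (fun i : ℕ => x ^ i / (i.factorial : ℝ)) (Real.exp x) := by
    intro x
    rw [Real.exp_eq_exp_ℝ]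
    exact NormedSpace.expSeries_div_hasSum_exp x
  have h1 := (hasSum_nat_add_iff' K).mpr (hs z)
  have h2 : HasSum (fun i : ℕ => (|z| / y) ^ K * (y ^ (i + K) / ((i + K).factorial : ℝ)))
      ((|z| / y) ^ K * (Real.exp y - ∑ i ∈ Finset.range K, y ^ i / (i.factorial : ℝ))) :=
    ((hasSum_nat_add_iff' K).mpr (hs y)).mul_left _
  have hle : ∀ i : ℕ, ‖z ^ (i + K) / ((i + K).factorial : ℝ)‖
      ≤ (|z| / y) ^ K * (y ^ (i + K) / ((i + K).factorial : ℝ)) := by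
    intro i
    rw [Real.norm_eq_abs, abs_div, abs_pow, Nat.abs_cast, ← mul_div_assoc]
    gcongr
    calc |z| ^ (i + K) = (|z| / y) ^ (i + K) * y ^ (i + K) := by
          rw [div_pow]; field_simp
      _ ≤ (|z| / y) ^ K * y ^ (i + K) := by
          gcongr ?_ * _
          exact pow_le_pow_of_le_one (by positivity) ((div_le_one hy).mpr hz) (by omega)
  have h3 := tsum_of_norm_bounded h2 hle
  rw [h1.tsum_eq, Real.norm_eq_abs] at h3
  refine h3.trans ?_
  gcongr
  have : 0 ≤ ∑ i ∈ Finset.range K, y ^ i / (i.factorial : ℝ) := by positivity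
  linarith

/-- Siegel's lemma for nonnegative coefficients, with one bound per equation. -/
theorem exists_int_relation {ι : Type*} [Fintype ι] [Nonempty ι] (n Z : ℕ) (A : ι → ℕ → ℕ)
    (b : ℕ → ℕ) (hA : ∀ i, ∀ k < n, A i k ≤ b k) (hb : ∀ k < n, 1 ≤ b k)
    (h : (∏ k ∈ Finset.range n, Fintype.card ι * b k) * (Z + 1) ^ n
      < (Z + 1) ^ Fintype.card ι) :
    ∃ c : ι → ℤ, c ≠ 0 ∧ (∀ i, |c i| ≤ Z) ∧ ∀ k < n, ∑ i, c i * (A i k : ℤ) = 0 := by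
  classical
  let S : Finset (ι → ℕ) := Fintype.piFinset fun _ => Finset.range (Z + 1)
  let R : Finset (Fin n → ℕ) :=
    Fintype.piFinset fun k => Finset.range ((Z + 1) * (Fintype.card ι * b k))
  let f : (ι → ℕ) → Fin n → ℕ := fun c k => ∑ i, c i * A i k
  have hcard : R.card < S.card := by
    simp only [R, S, Fintype.card_piFinset, Finset.card_range, Finset.prod_const,
      Finset.card_univ, Finset.prod_mul_distrib, Fintype.card_fin]
    rw [Finset.prod_mul_distrib, Finset.prod_const, Finset.card_range] at h
    rw [Fin.prod_univ_eq_prod_range]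
    linarith
  have hmaps : ∀ c ∈ S, f c ∈ R := by
    intro c hc
    simp only [S, R, f, Fintype.mem_piFinset, Finset.mem_range] at hc ⊢
    intro k
    have hc1 : 1 ≤ Fintype.card ι := Fintype.card_pos
    have hb1 := hb k k.2
    calc ∑ i, c i * A i k ≤ ∑ _i : ι, Z * b k :=
          Finset.sum_le_sum fun i _ =>
            Nat.mul_le_mul (Nat.lt_succ_iff.mp (hc i)) (hA i k k.2)
      _ = Z * (Fintype.card ι * b k) := by
          simp [Finset.card_univ]; ring
      _ < (Z + 1) * (Fintype.card ι * b k) := by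
          have : 0 < Fintype.card ι * b k := by positivity
          nlinarith
  obtain ⟨x, hx, y, hy, hxy, he⟩ :=
    Finset.exists_ne_map_eq_of_card_lt_of_maps_to hcard hmaps
  refine ⟨fun i => (x i : ℤ) - y i, ?_, ?_, ?_⟩
  · intro h0
    apply hxy
    funext i
    have := congrFun h0 i
    simp only [Pi.zero_apply] at this
    omega
  · intro i
    simp only [S, Fintype.mem_piFinset, Finset.mem_range] at hx hy
    have h1 := hx i
    have h2 := hy i
    change |(x i : ℤ) - y i| ≤ Z
    rw [abs_le]
    constructor <;> omega
  · intro k hk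
    have := congrFun he ⟨k, hk⟩
    simp only [f] at this
    have h2 : ((∑ i, x i * A i k : ℕ) : ℤ) = ((∑ i, y i * A i k : ℕ) : ℤ) := by
      exact_mod_cast this
    push_cast at h2
    simp only [sub_mul, Finset.sum_sub_distrib]
    linarith

open Polynomial in
/-- Zero estimate for `P₀(T) + P₁(T) W` on points `T = i + k j`, `W = α ^ i * w j`. -/
theorem eq_zero_of_eval_add_eval_mul_eq_zero {I J n₀ n₁ : ℕ} {k : ℕ → ℕ} {w : ℕ → ℝ} {α : ℝ}
    (hα0 : 0 < α) (hα : α ≠ 1) (hw : ∀ j, 0 < w j)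
    (hk : ∀ j j', j < j' → k j + I ≤ k j') (hn₀ : 0 < n₀) (hn₁ : 0 < n₁)
    (hIJ : n₀ + n₁ ≤ (I - 1) * J) {P₀ P₁ : ℝ[X]} (hP₀ : P₀.natDegree < n₀)
    (hP₁ : P₁.natDegree < n₁)
    (hz : ∀ i < I, ∀ j < J, P₀.eval ((i + k j : ℕ) : ℝ)
      + P₁.eval ((i + k j : ℕ) : ℝ) * (α ^ i * w j) = 0) :
    P₀ = 0 ∧ P₁ = 0 := by
  classical
  have key : ∀ Q : ℝ[X], Q.natDegree < n₀ + n₁ →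
      (∀ i < I - 1, ∀ j < J, Q.eval ((i + k j : ℕ) : ℝ) = 0) → Q = 0 := by
    intro Q hQ hv
    have hinj : Function.Injective
        (fun x : Fin (I - 1) × Fin J => (((x.1 : ℕ) + k x.2 : ℕ) : ℝ)) := by
      rintro ⟨i, j⟩ ⟨i', j'⟩ h
      have h' : (i : ℕ) + k j = i' + k j' := by
        have h2 : (((i : ℕ) + k j : ℕ) : ℝ) = (((i' : ℕ) + k j' : ℕ) : ℝ) := h
        exact_mod_cast h2
      have hi := i.2
      have hi' := i'.2
      rcases lt_trichotomy (j : ℕ) j' with hj | hj | hj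
      · have := hk _ _ hj; omega
      · rw [hj] at h'
        ext <;> simp <;> omega
      · have := hk _ _ hj; omega
    refine eq_zero_of_natDegree_lt_card_of_eval_eq_zero Q hinj (fun x => hv _ x.1.2 _ x.2.2) ?_
    simp only [Fintype.card_prod, Fintype.card_fin]
    omega
  have hQ := key (C α * (P₀ * taylor 1 P₁) - P₁ * taylor 1 P₀) ?_ ?_
  · have hlc : α * (P₀.leadingCoeff * P₁.leadingCoeff)
        = P₁.leadingCoeff * P₀.leadingCoeff := by
      have := congrArg leadingCoeff (sub_eq_zero.mp hQ)
      simpa [leadingCoeff_mul, leadingCoeff_taylor] using this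
    have h0 : P₀.leadingCoeff = 0 ∨ P₁.leadingCoeff = 0 := by
      by_contra! hne
      apply hα
      have : P₀.leadingCoeff * P₁.leadingCoeff ≠ 0 := mul_ne_zero hne.1 hne.2
      apply mul_right_cancel₀ this
      linarith
    rcases h0 with h0 | h0 <;> rw [leadingCoeff_eq_zero] at h0
    · refine ⟨h0, key P₁ (by omega) fun i hi j hj => ?_⟩
      have := hz i (by omega) j hj
      rw [h0, eval_zero, zero_add] at this
      exact (mul_eq_zero.mp this).resolve_right (mul_pos (pow_pos hα0 i) (hw j)).ne'
    · refine ⟨key P₀ (by omega) fun i hi j hj => ?_, h0⟩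
      have := hz i (by omega) j hj
      simpa [h0] using this
  · have h1 : (P₀ * taylor 1 P₁).natDegree ≤ P₀.natDegree + P₁.natDegree := by
      simpa using natDegree_mul_le (p := P₀) (q := taylor 1 P₁)
    have h2 : (P₁ * taylor 1 P₀).natDegree ≤ P₁.natDegree + P₀.natDegree := by
      simpa using natDegree_mul_le (p := P₁) (q := taylor 1 P₀)
    have h3 : (C α * (P₀ * taylor 1 P₁)).natDegree ≤ P₀.natDegree + P₁.natDegree :=
      (natDegree_C_mul_le _ _).trans h1
    have h4 := natDegree_sub_le (C α * (P₀ * taylor 1 P₁)) (P₁ * taylor 1 P₀)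
    have h5 := max_le h3 (h2.trans (by omega : _ ≤ P₀.natDegree + P₁.natDegree))
    omega
  · intro i hi j hj
    have e1 := hz i (by omega) j hj
    have e2 := hz (i + 1) (by omega) j hj
    have e3 : ((i + 1 + k j : ℕ) : ℝ) = ((i + k j : ℕ) : ℝ) + 1 := by push_cast; ring
    rw [e3, pow_succ] at e2
    simp only [eval_sub, eval_mul, eval_C, taylor_eval]
    set t := ((i + k j : ℕ) : ℝ)
    linear_combination α * P₁.eval (t + 1) * e1 - P₁.eval t * e2

open Polynomial in
/-- A functional killing `choose · k` for `k < n` kills all polynomials of degree `< n`. -/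
theorem sum_mul_eval_eq_zero {ι : Type*} [Fintype ι] {n : ℕ} {c : ι → ℝ} {T : ι → ℕ}
    (h : ∀ k < n, ∑ i, c i * ((T i).choose k : ℝ) = 0) (P : ℝ[X]) (hP : P.degree < n) :
    ∑ i, c i * P.eval (T i : ℝ) = 0 := by
  induction n generalizing P with
  | zero =>
    have : P = 0 := by
      rw [← degree_eq_bot]
      simpa using hP
    simp [this]
  | succ n ih =>
    have hm : (descPochhammer ℝ n).Monic := monic_descPochhammer ℝ n
    have hd : (descPochhammer ℝ n).natDegree = n := descPochhammer_natDegree ℝ n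
    have hQ : (P - C (P.coeff n) * descPochhammer ℝ n).degree < n := by
      rw [degree_lt_iff_coeff_zero]
      intro m hm'
      have hdeg := (degree_lt_iff_coeff_zero _ _).mp hP
      rcases hm'.eq_or_lt with rfl | hlt
      · have : (descPochhammer ℝ n).coeff n = 1 := by
          have := hm.coeff_natDegree
          rwa [hd] at this
        simp [this]
      · have : (descPochhammer ℝ n).coeff m = 0 :=
          coeff_eq_zero_of_natDegree_lt (by omega)
        rw [coeff_sub, coeff_C_mul, hdeg m (by omega), this]
        simp
    have h1 := ih (fun k hk => h k (by omega)) _ hQ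
    have h2 : ∑ i, c i * (descPochhammer ℝ n).eval (T i : ℝ) = 0 := by
      have : ∀ i, (descPochhammer ℝ n).eval (T i : ℝ)
          = (n.factorial : ℝ) * ((T i).choose n : ℝ) := by
        intro i
        rw [descPochhammer_eval_eq_descFactorial, Nat.descFactorial_eq_factorial_mul_choose]
        push_cast
        ring
      simp only [this]
      calc ∑ i, c i * ((n.factorial : ℝ) * ((T i).choose n : ℝ))
          = (n.factorial : ℝ) * ∑ i, c i * ((T i).choose n : ℝ) := by
            rw [Finset.mul_sum]; exact Finset.sum_congr rfl fun i _ => by ring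
        _ = 0 := by rw [h n (by omega), mul_zero]
    have h3 : ∑ i, c i * P.eval (T i : ℝ)
        = ∑ i, c i * (P - C (P.coeff n) * descPochhammer ℝ n).eval (T i : ℝ)
          + P.coeff n * ∑ i, c i * (descPochhammer ℝ n).eval (T i : ℝ) := by
      rw [Finset.mul_sum, ← Finset.sum_add_distrib]
      refine Finset.sum_congr rfl fun i _ => ?_
      simp only [eval_sub, eval_mul, eval_C]
      ring
    rw [h3, h1, h2]
    simp

/-- Points at which monomials and monomials times `W` form a nonsingular square system. -/
theorem exists_nonsingular_points {I J n₀ n₁ : ℕ} {k : ℕ → ℕ} {w : ℕ → ℝ} {α : ℝ}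
    (hα0 : 0 < α) (hα : α ≠ 1) (hw : ∀ j, 0 < w j)
    (hk : ∀ j j', j < j' → k j + I ≤ k j') (hn₀ : 0 < n₀) (hn₁ : 0 < n₁)
    (hIJ : n₀ + n₁ ≤ (I - 1) * J) :
    ∃ s : Fin (n₀ + n₁) → ℕ × ℕ, (∀ x, (s x).1 < I ∧ (s x).2 < J) ∧
      ∀ c : Fin (n₀ + n₁) → ℝ,
        (∀ l < n₀, ∑ x, c x * (((s x).1 + k (s x).2 : ℕ) : ℝ) ^ l = 0) →
        (∀ l < n₁, ∑ x, c x * ((((s x).1 + k (s x).2 : ℕ) : ℝ) ^ l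
          * (α ^ (s x).1 * w (s x).2)) = 0) → c = 0 := by
  classical
  let r : Fin I × Fin J → (Fin n₀ ⊕ Fin n₁ → ℝ) := fun y => Sum.elim
    (fun l => (((y.1 : ℕ) + k y.2 : ℕ) : ℝ) ^ (l : ℕ))
    (fun l => (((y.1 : ℕ) + k y.2 : ℕ) : ℝ) ^ (l : ℕ) * (α ^ (y.1 : ℕ) * w y.2))
  have hspan : Submodule.span ℝ (Set.range r) = ⊤ := by
    by_contra hne
    obtain ⟨f, hf0, hf⟩ := Submodule.exists_le_ker_of_lt_top _ (lt_top_iff_ne_top.mpr hne)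
    have hfr : ∀ y, f (r y) = 0 := fun y => hf (Submodule.subset_span ⟨y, rfl⟩)
    have hfs : ∀ v, f v = ∑ z, v z * f (Pi.single z 1) := by
      intro v
      conv_lhs => rw [pi_eq_sum_univ' v]
      simp [map_sum]
    let P₀ : Polynomial ℝ :=
      ∑ l : Fin n₀, Polynomial.monomial (l : ℕ) (f (Pi.single (Sum.inl l) 1))
    let P₁ : Polynomial ℝ :=
      ∑ l : Fin n₁, Polynomial.monomial (l : ℕ) (f (Pi.single (Sum.inr l) 1))
    have hdeg : ∀ (n : ℕ) (a : Fin n → ℝ), 0 < n →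
        (∑ l : Fin n, Polynomial.monomial (l : ℕ) (a l)).natDegree < n := by
      intro n a hn
      have : (∑ l : Fin n, Polynomial.monomial (l : ℕ) (a l)).natDegree ≤ n - 1 :=
        Polynomial.natDegree_sum_le_of_forall_le _ _ fun l _ =>
          (Polynomial.natDegree_monomial_le _).trans (by omega)
      omega
    have hcoeff : ∀ (n : ℕ) (a : Fin n → ℝ) (l : Fin n),
        (∑ l : Fin n, Polynomial.monomial (l : ℕ) (a l)).coeff l = a l := by
      intro n a l
      simp [Polynomial.coeff_monomial, Fin.val_inj]
    have h0 := eq_zero_of_eval_add_eval_mul_eq_zero (P₀ := P₀) (P₁ := P₁) hα0 hα hw hk hn₀ hn₁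
      hIJ (hdeg _ _ hn₀) (hdeg _ _ hn₁) (by
        intro i hi j hj
        have := hfr (⟨i, hi⟩, ⟨j, hj⟩)
        rw [hfs, Fintype.sum_sum_type] at this
        simp only [r, Sum.elim_inl, Sum.elim_inr] at this
        rw [← this]
        simp only [P₀, P₁, Polynomial.eval_finsetSum, Polynomial.eval_monomial, Finset.sum_mul]
        congr 1 <;> refine Finset.sum_congr rfl fun l _ => ?_ <;> ring)
    apply hf0
    ext z
    simp only [LinearMap.coe_comp, Function.comp_apply, LinearMap.coe_single,
      LinearMap.zero_apply]
    rcases z with l | l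
    · rw [← hcoeff n₀ (fun l => f (Pi.single (Sum.inl l) 1)) l]
      exact congrArg (fun P => Polynomial.coeff P (l : ℕ)) h0.1
    · rw [← hcoeff n₁ (fun l => f (Pi.single (Sum.inr l) 1)) l]
      exact congrArg (fun P => Polynomial.coeff P (l : ℕ)) h0.2
  obtain ⟨κ, a, ha, hs, hli⟩ := exists_linearIndependent' ℝ r
  have : Finite κ := Finite.of_injective a ha
  have := Fintype.ofFinite κ
  have hcard : Fintype.card κ = n₀ + n₁ := by
    have h1 := finrank_span_eq_card hli
    rw [hs, hspan, finrank_top] at h1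
    simpa using h1.symm
  let e : Fin (n₀ + n₁) ≃ κ := (Fintype.equivFinOfCardEq hcard).symm
  refine ⟨fun x => ((a (e x)).1, (a (e x)).2), fun x => ⟨(a (e x)).1.2, (a (e x)).2.2⟩, ?_⟩
  intro c hc0 hc1
  have hli' : LinearIndependent ℝ ((r ∘ a) ∘ e) := hli.comp e e.injective
  rw [Fintype.linearIndependent_iff] at hli'
  funext x
  refine hli' c ?_ x
  ext z
  rcases z with l | l
  · simpa [r] using hc0 l l.2
  · simpa [r] using hc1 l l.2

/-- A linear combination of near-exponential values that almost vanishes and has a common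
denominator of controlled size is zero. -/
theorem sum_choose_mul_eq_zero {ι : Type*} [Fintype ι] {d x : ℕ} (hd : 100 ≤ d) (hx : x < d)
    (hcard : Fintype.card ι = 3 * d) {τ D : ℝ} {c : ι → ℤ} {T : ι → ℕ} {W : ι → ℝ}
    (hT : ∀ i, T i ≤ 19 * d) (hτ : |τ| ≤ 2.5e-10) (hD0 : 0 < D) (hD : D ≤ Real.exp (4 * d))
    (hW : ∀ i, |W i - Real.exp (τ * T i)| ≤ d * Real.exp (-17.8 * d))
    (hz : ∀ i, ∃ z : ℤ, D * W i = z) (hc : ∀ i, |(c i : ℝ)| ≤ 9 * d ^ 2 * Real.exp (8 * d))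
    (h0 : ∀ k < 2 * d, ∑ i, (c i : ℝ) * ((T i).choose k : ℝ) = 0) :
    ∑ i, (c i : ℝ) * ((T i).choose x : ℝ) * W i = 0 := by
  have hd0 : (100 : ℝ) ≤ d := by exact_mod_cast hd
  have hdpos : (0 : ℝ) < d := by linarith
  have he19 : (19 : ℝ) ≤ Real.exp 3 := by
    have := Real.exp_one_gt_d9
    rw [show (3 : ℝ) = ((3 : ℕ) : ℝ) * 1 by norm_num, Real.exp_nat_mul]
    calc (19 : ℝ) ≤ 2.7 ^ 3 := by norm_num
      _ ≤ _ := by gcongr; linarith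
  have hTd : ∀ i, (T i : ℝ) / d ≤ 19 := by
    intro i
    rw [div_le_iff₀ hdpos]
    exact_mod_cast hT i
  have hch : ∀ i, ((T i).choose x : ℝ) ≤ Real.exp (4 * d) := by
    intro i
    calc ((T i).choose x : ℝ) ≤ (T i / d) ^ x * Real.exp d :=
          choose_le_div_pow_mul_exp _ _ hdpos
      _ ≤ (19 : ℝ) ^ d * Real.exp d := by
          gcongr ?_ * _
          calc ((T i : ℝ) / d) ^ x ≤ 19 ^ x := by gcongr; exact hTd i
            _ ≤ 19 ^ d := pow_le_pow_right₀ (by norm_num) hx.le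
      _ ≤ Real.exp 3 ^ d * Real.exp d := by gcongr
      _ = Real.exp (4 * d) := by
          rw [← Real.exp_nat_mul, ← Real.exp_add]; congr 1; ring
  let p : ℝ → ℝ := fun t => ∑ i ∈ Finset.range (2 * d - x), (τ * t) ^ i / (i.factorial : ℝ)
  have hp : ∀ i, |Real.exp (τ * T i) - p (T i)| ≤ Real.exp (-18 * d) := by
    intro i
    have hab : |τ * T i| ≤ 4.75e-9 * d := by
      rw [abs_mul, Nat.abs_cast]
      calc |τ| * (T i : ℝ) ≤ 2.5e-10 * (19 * d) := by
            gcongr; exact_mod_cast hT i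
        _ = _ := by ring
    have hlt : Real.exp 19 * 4.75e-9 ≤ 1 := by
      have := Real.exp_one_lt_d9
      rw [show (19 : ℝ) = ((19 : ℕ) : ℝ) * 1 by norm_num, Real.exp_nat_mul]
      calc Real.exp 1 ^ 19 * 4.75e-9 ≤ 2.7182818286 ^ 19 * 4.75e-9 := by gcongr
        _ ≤ 1 := by norm_num
    calc |Real.exp (τ * T i) - p (T i)|
        ≤ (|τ * T i| / d) ^ (2 * d - x) * Real.exp d :=
          abs_exp_sub_sum_le hdpos (hab.trans (by linarith)) _
      _ ≤ (4.75e-9 : ℝ) ^ (2 * d - x) * Real.exp d := by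
          gcongr
          rwa [div_le_iff₀ hdpos]
      _ ≤ (4.75e-9 : ℝ) ^ d * Real.exp d := by
          gcongr ?_ * _
          exact pow_le_pow_of_le_one (by norm_num) (by norm_num) (by omega)
      _ ≤ Real.exp (-19) ^ d * Real.exp d := by
          gcongr
          rw [Real.exp_neg, le_inv_comm₀ (by norm_num) (Real.exp_pos _)]
          rw [← one_div, le_div_iff₀ (by norm_num)]
          exact hlt
      _ = Real.exp (-18 * d) := by
          rw [← Real.exp_nat_mul, ← Real.exp_add]; congr 1; ring
  have hpz : ∑ i, (c i : ℝ) * ((T i).choose x : ℝ) * p (T i) = 0 := by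
    let P : Polynomial ℝ := Polynomial.C ((x.factorial : ℝ)⁻¹) * descPochhammer ℝ x *
      ∑ i ∈ Finset.range (2 * d - x), Polynomial.monomial i (τ ^ i / (i.factorial : ℝ))
    have hP : P.degree < (2 * d : ℕ) := by
      refine Polynomial.degree_le_natDegree.trans_lt (Nat.cast_lt.mpr ?_)
      have e1 : (Polynomial.C ((x.factorial : ℝ)⁻¹) * descPochhammer ℝ x).natDegree ≤ x :=
        (Polynomial.natDegree_C_mul_le _ _).trans (descPochhammer_natDegree ℝ x).le
      have e2 : (∑ i ∈ Finset.range (2 * d - x),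
          Polynomial.monomial i (τ ^ i / (i.factorial : ℝ))).natDegree ≤ 2 * d - x - 1 :=
        Polynomial.natDegree_sum_le_of_forall_le _ _ fun l hl =>
          (Polynomial.natDegree_monomial_le _).trans (by
            rw [Finset.mem_range] at hl; omega)
      have e3 := Polynomial.natDegree_mul_le
        (p := Polynomial.C ((x.factorial : ℝ)⁻¹) * descPochhammer ℝ x)
        (q := ∑ i ∈ Finset.range (2 * d - x),
          Polynomial.monomial i (τ ^ i / (i.factorial : ℝ)))
      change (_ * _ : Polynomial ℝ).natDegree < 2 * d
      omega
    have := sum_mul_eval_eq_zero h0 P hP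
    rw [← this]
    refine Finset.sum_congr rfl fun i _ => ?_
    simp only [P, p, Polynomial.eval_mul, Polynomial.eval_C, Polynomial.eval_finsetSum,
      Polynomial.eval_monomial, descPochhammer_eval_eq_descFactorial,
      Nat.descFactorial_eq_factorial_mul_choose]
    have hf : (x.factorial : ℝ) ≠ 0 := by positivity
    push_cast
    rw [mul_assoc, inv_mul_cancel_left₀ hf]
    congr 2
    refine Finset.sum_congr rfl fun l _ => ?_
    rw [mul_pow]; ring
  choose z hz using hz
  have hS : D * ∑ i, (c i : ℝ) * ((T i).choose x : ℝ) * W i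
      = ((∑ i, c i * ((T i).choose x : ℤ) * z i : ℤ) : ℝ) := by
    push_cast
    rw [Finset.mul_sum]
    refine Finset.sum_congr rfl fun i _ => ?_
    rw [← hz i]; ring
  have hbig : 54 * (d : ℝ) ^ 4 < Real.exp (1.8 * d) := by
    have h1 : (d : ℝ) ^ 8 / (Nat.factorial 8 : ℝ) ≤ Real.exp d :=
      Real.pow_div_factorial_le_exp _ hdpos.le 8
    have h2 : Real.exp d ≤ Real.exp (1.8 * d) := Real.exp_le_exp.mpr (by linarith)
    have h3 : (100 : ℝ) ^ 4 ≤ (d : ℝ) ^ 4 := by gcongr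
    have h4 : (Nat.factorial 8 : ℝ) = 40320 := by norm_num [Nat.factorial]
    rw [h4, div_le_iff₀ (by norm_num)] at h1
    nlinarith
  have hlt : |D * ∑ i, (c i : ℝ) * ((T i).choose x : ℝ) * W i| < 1 := by
    have e : ∑ i, (c i : ℝ) * ((T i).choose x : ℝ) * W i
        = ∑ i, (c i : ℝ) * ((T i).choose x : ℝ) * (W i - p (T i)) := by
      simp only [mul_sub, Finset.sum_sub_distrib, hpz, sub_zero]
    have hterm : ∀ i, |W i - p (T i)| ≤ 2 * d * Real.exp (-17.8 * d) := by
      intro i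
      have h1 : |W i - p (T i)| ≤ |W i - Real.exp (τ * T i)| + |Real.exp (τ * T i) - p (T i)| :=
        abs_sub_le _ _ _
      have h2 : Real.exp (-18 * d) ≤ Real.exp (-17.8 * d) := Real.exp_le_exp.mpr (by linarith)
      have h3 := Real.exp_pos (-17.8 * d)
      nlinarith [hW i, hp i]
    have hsum : |∑ i, (c i : ℝ) * ((T i).choose x : ℝ) * (W i - p (T i))|
        ≤ (3 * d) * ((9 * d ^ 2 * Real.exp (8 * d)) * Real.exp (4 * d)
          * (2 * d * Real.exp (-17.8 * d))) := by
      calc |∑ i, (c i : ℝ) * ((T i).choose x : ℝ) * (W i - p (T i))|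
          ≤ ∑ i, |(c i : ℝ) * ((T i).choose x : ℝ) * (W i - p (T i))| :=
            Finset.abs_sum_le_sum_abs _ _
        _ ≤ ∑ _i : ι, (9 * d ^ 2 * Real.exp (8 * d)) * Real.exp (4 * d)
              * (2 * d * Real.exp (-17.8 * d)) := by
            refine Finset.sum_le_sum fun i _ => ?_
            rw [abs_mul, abs_mul, Nat.abs_cast]
            have := hc i
            have := hch i
            have := hterm i
            gcongr
        _ = _ := by
            rw [Finset.sum_const, Finset.card_univ, hcard, nsmul_eq_mul]
            push_cast; ring
    rw [e, abs_mul, abs_of_pos hD0]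
    calc D * |∑ i, (c i : ℝ) * ((T i).choose x : ℝ) * (W i - p (T i))|
        ≤ Real.exp (4 * d) * ((3 * d) * ((9 * d ^ 2 * Real.exp (8 * d)) * Real.exp (4 * d)
          * (2 * d * Real.exp (-17.8 * d)))) := by gcongr
      _ = 54 * (d : ℝ) ^ 4 * Real.exp (-(1.8 * d)) := by
          have : Real.exp (-(1.8 * d)) = Real.exp (4 * d) * Real.exp (8 * d) * Real.exp (4 * d)
              * Real.exp (-17.8 * d) := by
            rw [← Real.exp_add, ← Real.exp_add, ← Real.exp_add]; congr 1; ring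
          rw [this]; ring
      _ < 1 := by
          rw [Real.exp_neg, ← div_eq_mul_inv, div_lt_one (Real.exp_pos _)]
          exact hbig
  rw [hS] at hlt
  have hzero : (∑ i, c i * ((T i).choose x : ℤ) * z i : ℤ) = 0 := by
    rw [← Int.abs_lt_one_iff]
    exact_mod_cast hlt
  rw [hzero, Int.cast_zero] at hS
  exact (mul_eq_zero.mp hS).resolve_left hD0.ne'

/-- The powers of a real number very close to `1` cannot have small denominators at many points. -/
theorem no_small_denominators {I J d : ℕ} {k : ℕ → ℕ} {α ρ D : ℝ} (hd : 100 ≤ d)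
    (hα0 : 0 < α) (hα : α ≠ 1) (hlog : |Real.log α| ≤ 2.5e-10) (hρ : 1 ≤ ρ)
    (hρ' : ρ - 1 ≤ Real.exp (-17.9 * d)) (hJ : J ≤ d) (hIJ : 3 * d ≤ (I - 1) * J)
    (hk : ∀ j j', j < j' → k j + I ≤ k j') (hT : ∀ i < I, ∀ j < J, i + k j ≤ 19 * d)
    (hD0 : 0 < D) (hD : D ≤ Real.exp (4 * d))
    (hz : ∀ i < I, ∀ j < J, ∃ z : ℤ, D * (α ^ (i + k j) / ρ ^ j) = z) : False := by
  have hd0 : (100 : ℝ) ≤ d := by exact_mod_cast hd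
  have hdpos : (0 : ℝ) < d := by linarith
  have hρ0 : 0 < ρ := by linarith
  obtain ⟨s, hs, hind⟩ := exists_nonsingular_points (I := I) (J := J) (n₀ := 2 * d) (n₁ := d)
    (k := k) (w := fun j => α ^ k j / ρ ^ j) hα0 hα (fun j => by positivity) hk
    (by omega) (by omega) (by omega)
  let T : Fin (2 * d + d) → ℕ := fun x => (s x).1 + k (s x).2
  let W : Fin (2 * d + d) → ℝ := fun x => α ^ T x / ρ ^ (s x).2
  have hTd : ∀ x, T x ≤ 19 * d := fun x => hT _ (hs x).1 _ (hs x).2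
  have hcard : Fintype.card (Fin (2 * d + d)) = 3 * d := by
    rw [Fintype.card_fin]; ring
  have hαT : ∀ x, α ^ T x = Real.exp (Real.log α * T x) := by
    intro x
    rw [mul_comm, Real.exp_nat_mul, Real.exp_log hα0]
  have hW : ∀ x, |W x - Real.exp (Real.log α * T x)| ≤ d * Real.exp (-17.8 * d) := by
    intro x
    have hj : ((s x).2 : ℝ) ≤ d := by
      exact_mod_cast (hs x).2.le.trans hJ
    have hinv1 : 1 - (ρ - 1) ≤ ρ⁻¹ := by
      rw [← one_div, le_div_iff₀ hρ0]; nlinarith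
    have hinv2 : ρ⁻¹ ≤ 1 := inv_le_one_of_one_le₀ hρ
    have hinv0 : 0 < ρ⁻¹ := by positivity
    have hb : 1 - d * Real.exp (-17.9 * d) ≤ ρ⁻¹ ^ (s x).2 := by
      have h1 := one_add_mul_le_pow (a := ρ⁻¹ - 1) (by linarith) (s x).2
      rw [add_sub_cancel] at h1
      have h2 : (1 - ρ⁻¹) ≤ Real.exp (-17.9 * d) := by linarith
      have h3 : ((s x).2 : ℝ) * (1 - ρ⁻¹) ≤ d * Real.exp (-17.9 * d) := by
        gcongr
      linarith
    have hb' : ρ⁻¹ ^ (s x).2 ≤ 1 := pow_le_one₀ hinv0.le hinv2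
    have hTe : Real.exp (Real.log α * T x) ≤ Real.exp (0.1 * d) := by
      apply Real.exp_le_exp.mpr
      have h1 : (T x : ℝ) ≤ 19 * d := by exact_mod_cast hTd x
      have h2 : Real.log α ≤ 2.5e-10 := (le_abs_self _).trans hlog
      calc Real.log α * T x ≤ 2.5e-10 * (19 * d) := by gcongr
        _ ≤ 0.1 * d := by linarith
    have : W x - Real.exp (Real.log α * T x)
        = -(Real.exp (Real.log α * T x) * (1 - ρ⁻¹ ^ (s x).2)) := by
      simp only [W]
      rw [hαT, div_eq_mul_inv, inv_pow]; ring
    rw [this, abs_neg, abs_of_nonneg (mul_nonneg (Real.exp_pos _).le (by linarith))]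
    calc Real.exp (Real.log α * T x) * (1 - ρ⁻¹ ^ (s x).2)
        ≤ Real.exp (0.1 * d) * (d * Real.exp (-17.9 * d)) := by
          gcongr
          · linarith
      _ = d * Real.exp (-17.8 * d) := by
          rw [mul_left_comm, ← Real.exp_add]; congr 2; ring
  let Z : ℕ := ⌊9 * (d : ℝ) ^ 2 * Real.exp (8 * d)⌋₊
  have hZ1 : (Z : ℝ) ≤ 9 * (d : ℝ) ^ 2 * Real.exp (8 * d) := Nat.floor_le (by positivity)
  have hZ2 : 9 * (d : ℝ) ^ 2 * Real.exp (8 * d) < Z + 1 := Nat.lt_floor_add_one _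
  have hne : Nonempty (Fin (2 * d + d)) := ⟨⟨0, by omega⟩⟩
  obtain ⟨c, hc0, hcZ, hc⟩ := exists_int_relation (ι := Fin (2 * d + d)) (2 * d) Z
    (fun x k => (T x).choose k) (fun k => (19 * d).choose k)
    (fun x k _ => Nat.choose_le_choose k (hTd x))
    (fun k hk => Nat.choose_pos (by omega)) (by
      rw [hcard, show 3 * d = d + 2 * d by ring, pow_add]
      refine mul_lt_mul_of_pos_right ?_ (by positivity)
      rw [← Nat.cast_lt (α := ℝ)]
      push_cast
      have hfac : ∀ k ∈ Finset.range (2 * d),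
          (d + 2 * d : ℝ) * ((19 * d).choose k : ℝ) ≤ (3 * d * Real.exp d) * Real.exp 3 ^ k := by
        intro k _
        have h1 := choose_le_div_pow_mul_exp (19 * d) k hdpos
        have h2 : ((19 * d : ℕ) : ℝ) / d = 19 := by
          push_cast; field_simp
        rw [h2] at h1
        have h3 : (19 : ℝ) ≤ Real.exp 3 := by
          have := Real.exp_one_gt_d9
          rw [show (3 : ℝ) = ((3 : ℕ) : ℝ) * 1 by norm_num, Real.exp_nat_mul]
          calc (19 : ℝ) ≤ 2.7 ^ 3 := by norm_num
            _ ≤ _ := by gcongr; linarith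
        calc (d + 2 * d : ℝ) * ((19 * d).choose k : ℝ)
            ≤ (d + 2 * d : ℝ) * (Real.exp 3 ^ k * Real.exp d) := by
              gcongr
              exact h1.trans (by gcongr)
          _ = _ := by ring
      calc ∏ k ∈ Finset.range (2 * d), (d + 2 * d : ℝ) * ((19 * d).choose k : ℝ)
          ≤ ∏ k ∈ Finset.range (2 * d), (3 * d * Real.exp d) * Real.exp 3 ^ k :=
            Finset.prod_le_prod (fun k _ => by positivity) hfac
        _ = (3 * d * Real.exp d) ^ (2 * d) * Real.exp 3 ^ (∑ k ∈ Finset.range (2 * d), k) := by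
            rw [Finset.prod_mul_distrib, Finset.prod_const, Finset.card_range,
              Finset.prod_pow_eq_pow_sum]
        _ ≤ (3 * d * Real.exp d) ^ (2 * d) * Real.exp 3 ^ (2 * d * d) := by
            gcongr
            · exact Real.one_le_exp (by norm_num)
            · have := Finset.sum_range_id_mul_two (2 * d)
              have h4 : 2 * d * (2 * d - 1) ≤ 2 * d * (2 * d) := by gcongr; omega
              nlinarith
        _ = (9 * (d : ℝ) ^ 2 * Real.exp (8 * d)) ^ d := by
            have h8 : Real.exp (8 * d) = Real.exp d ^ 2 * Real.exp 3 ^ (2 * d) := by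
              rw [← Real.exp_nat_mul, ← Real.exp_nat_mul, ← Real.exp_add]
              congr 1; push_cast; ring
            rw [h8, pow_mul, pow_mul (Real.exp 3), ← mul_pow]
            congr 1
            ring
        _ < (Z + 1 : ℝ) ^ d := by
            gcongr)
  have hcR : ∀ k < 2 * d, ∑ x, (c x : ℝ) * ((T x).choose k : ℝ) = 0 := by
    intro k hk
    exact_mod_cast hc k hk
  have hvan : ∀ k < d, ∑ x, ((c x : ℝ) * W x) * ((T x).choose k : ℝ) = 0 := by
    intro k hk
    rw [← sum_choose_mul_eq_zero hd hk hcard hTd hlog hD0 hD hW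
      (fun x => hz _ (hs x).1 _ (hs x).2)
      (fun x => (by exact_mod_cast hcZ x : |(c x : ℝ)| ≤ Z).trans hZ1) hcR]
    exact Finset.sum_congr rfl fun x _ => by ring
  have hX : ∀ l n : ℕ, l < n → (Polynomial.X ^ l : Polynomial ℝ).degree < n := by
    intro l n hl
    rw [Polynomial.degree_X_pow]
    exact_mod_cast hl
  apply hc0
  have := hind (fun x => (c x : ℝ)) ?_ ?_
  · funext x
    have hx : (c x : ℝ) = 0 := congrFun this x
    exact_mod_cast hx
  · intro l hl
    have := sum_mul_eval_eq_zero hcR (Polynomial.X ^ l) (hX l _ hl)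
    simpa [T] using this
  · intro l hl
    have := sum_mul_eval_eq_zero hvan (Polynomial.X ^ l) (hX l _ hl)
    rw [← this]
    refine Finset.sum_congr rfl fun x _ => ?_
    simp only [W, T, Polynomial.eval_pow, Polynomial.eval_X, pow_add]
    ring

/-- A common denominator for `(X ^ q / Y ^ p) ^ T / ρ ^ j`,
where `ρ = X ^ m (Y - 1) / ((X - 1) Y ^ n)`. -/
theorem exists_int_eq_den_mul {X Y m n p q B J T j : ℕ} (hX : 2 ≤ X) (hY : 2 ≤ Y) (hj : j ≤ J)
    (h₁ : m * j ≤ q + q * T) (h₂ : p * T ≤ B + n * j) :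
    ∃ z : ℤ, ((X : ℝ) ^ q * (Y : ℝ) ^ B * ((Y : ℝ) - 1) ^ J) *
      (((X : ℝ) ^ q / (Y : ℝ) ^ p) ^ T /
        ((X : ℝ) ^ m * ((Y : ℝ) - 1) / (((X : ℝ) - 1) * (Y : ℝ) ^ n)) ^ j) = z := by
  obtain ⟨a, ha⟩ := Nat.exists_eq_add_of_le h₁
  obtain ⟨b, hb⟩ := Nat.exists_eq_add_of_le h₂
  obtain ⟨e, rfl⟩ := Nat.exists_eq_add_of_le hj
  have hX' : (2 : ℝ) ≤ X := by exact_mod_cast hX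
  have hY' : (2 : ℝ) ≤ Y := by exact_mod_cast hY
  have hY1 : (Y : ℝ) - 1 ≠ 0 := by linarith
  have hX0 : (X : ℝ) ≠ 0 := by linarith
  have hY0 : (Y : ℝ) ≠ 0 := by linarith
  have eX : (X : ℝ) ^ q * (X : ℝ) ^ (q * T) = (X : ℝ) ^ (m * j) * (X : ℝ) ^ a := by
    rw [← pow_add, ← pow_add, ha]
  have eY : (Y : ℝ) ^ B * (Y : ℝ) ^ (n * j) = (Y : ℝ) ^ (p * T) * (Y : ℝ) ^ b := by
    rw [← pow_add, ← pow_add, hb]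
  refine ⟨(X : ℤ) ^ a * (Y : ℤ) ^ b * ((X : ℤ) - 1) ^ j * ((Y : ℤ) - 1) ^ e, ?_⟩
  push_cast
  rw [div_pow, div_pow, mul_pow, mul_pow, ← pow_mul, ← pow_mul, ← pow_mul, ← pow_mul,
    div_div_div_eq, ← mul_div_assoc, div_eq_iff (by simp [hX0, hY0, hY1]), pow_add]
  calc _ = ((X : ℝ) ^ q * (X : ℝ) ^ (q * T)) * ((Y : ℝ) ^ B * (Y : ℝ) ^ (n * j))
        * (((Y : ℝ) - 1) ^ j * ((Y : ℝ) - 1) ^ e * ((X : ℝ) - 1) ^ j) := by ring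
    _ = _ := by rw [eX, eY]; ring

/-- Bases of two long repunits with the same value are coprime. -/
theorem coprime_of_pow_mul_add_eq {X Y m n : ℕ} (hX : 2 ≤ X) (hXY : X < Y)
    (hrel : X ^ m * (Y - 1) + X = (X - 1) * Y ^ n + Y) (hnm : n ≤ m)
    (hlt : (m : ℝ) * Real.log X ≤ n * Real.log Y) (hm : 4e11 * Real.log Y ^ 2 ≤ m) :
    X.Coprime Y := by
  by_contra hcop
  obtain ⟨r, hr, hrX, hrY⟩ := Nat.Prime.not_coprime_iff_dvd.mp hcop
  have h1 : r ^ n ∣ X ^ m := (pow_dvd_pow_of_dvd hrX n).trans (pow_dvd_pow X hnm)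
  have h2 : r ^ n ∣ Y ^ n := pow_dvd_pow_of_dvd hrY n
  have h3 : r ^ n ∣ Y - X := by
    have e : X ^ m * (Y - 1) = (X - 1) * Y ^ n + (Y - X) := by omega
    exact (Nat.dvd_add_right (h2.mul_left (X - 1))).mp (e ▸ h1.mul_right (Y - 1))
  have h4 : 2 ^ n ≤ Y := by
    calc 2 ^ n ≤ r ^ n := Nat.pow_le_pow_left hr.two_le n
      _ ≤ Y - X := Nat.le_of_dvd (by omega) h3
      _ ≤ Y := Nat.sub_le _ _
  have h5 : (n : ℝ) * Real.log 2 ≤ Real.log Y := by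
    rw [← Real.log_pow]
    exact Real.log_le_log (by positivity) (by exact_mod_cast h4)
  have hl2 := Real.log_two_gt_d9
  have h6 : Real.log 2 ≤ Real.log X := Real.log_le_log (by norm_num) (by exact_mod_cast hX)
  have h7 : Real.log X ≤ Real.log Y :=
    Real.log_le_log (by positivity) (by exact_mod_cast hXY.le)
  have hm0 : (0 : ℝ) ≤ m := Nat.cast_nonneg m
  have hn0 : (0 : ℝ) ≤ n := Nat.cast_nonneg n
  have h8 : (n : ℝ) ≤ 2 * Real.log Y := by nlinarith
  have h9 : (m : ℝ) * 0.6 ≤ m * Real.log X := by gcongr; linarith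
  have h10 : (n : ℝ) * Real.log Y ≤ 2 * Real.log Y * Real.log Y := by gcongr
  nlinarith

/-- Dirichlet approximation of the ratio `L₁ / L₂` by positive integers. -/
theorem exists_small_linear_combination {L₁ L₂ : ℝ} (hL₁ : 0.5 ≤ L₁) (hL₂ : 1 ≤ L₂) :
    ∃ p q : ℕ, 0 < p ∧ 0 < q ∧ (q : ℝ) ≤ 4e9 * L₂ + 1 ∧ |q * L₁ - p * L₂| ≤ 2.5e-10 := by
  obtain ⟨Q, hQ1, hQ2⟩ : ∃ Q : ℕ, 4e9 * L₂ ≤ Q ∧ (Q : ℝ) < 4e9 * L₂ + 1 :=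
    ⟨⌈4e9 * L₂⌉₊, Nat.le_ceil _, Nat.ceil_lt_add_one (by linarith)⟩
  have hQ0 : 0 < Q := by
    have : (0 : ℝ) < Q := by linarith
    exact_mod_cast this
  obtain ⟨pz, qz, hq0, hqQ, happ⟩ := Real.exists_int_int_abs_mul_sub_le (L₁ / L₂) hQ0
  obtain ⟨q, rfl⟩ := Int.eq_ofNat_of_zero_le hq0.le
  have hq1 : (1 : ℝ) ≤ q := by exact_mod_cast hq0
  have hqQ' : (q : ℝ) ≤ Q := by exact_mod_cast hqQ
  have hτ' : |(q : ℝ) * L₁ - pz * L₂| ≤ 2.5e-10 := by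
    have hL20 : (0 : ℝ) < L₂ := by linarith
    have e : (q : ℝ) * L₁ - pz * L₂ = (L₁ / L₂ * ((q : ℤ) : ℝ) - pz) * L₂ := by
      push_cast
      field_simp
    rw [e, abs_mul, abs_of_pos hL20, mul_comm]
    rw [mul_comm (L₁ / L₂)]
    have h1 : |((q : ℤ) : ℝ) * (L₁ / L₂) - pz| ≤ 1 / (4e9 * L₂) := by
      refine happ.trans ?_
      gcongr
      linarith
    calc L₂ * |((q : ℤ) : ℝ) * (L₁ / L₂) - pz| ≤ L₂ * (1 / (4e9 * L₂)) := by gcongr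
      _ = 2.5e-10 := by field_simp; norm_num
  have hp0 : 0 < pz := by
    by_contra! h
    have h1 : (pz : ℝ) ≤ 0 := by exact_mod_cast h
    have h2 := (abs_le.mp hτ').2
    have h3 : (pz : ℝ) * L₂ ≤ 0 := mul_nonpos_of_nonpos_of_nonneg h1 (by linarith only [hL₂])
    have h4 : 1 * L₁ ≤ q * L₁ := by gcongr
    linarith only [h2, h3, h4, hL₁]
  obtain ⟨p, rfl⟩ := Int.eq_ofNat_of_zero_le hp0.le
  refine ⟨p, q, by exact_mod_cast hp0, by exact_mod_cast hq0, hqQ'.trans hQ2.le, ?_⟩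
  exact_mod_cast hτ'

set_option maxHeartbeats 1000000 in
/-- Two repunits of bases `X < Y` cannot agree when the first one is very long. -/
theorem not_repunit_eq_of_long {X Y m n : ℕ} (hX : 2 ≤ X) (hXY : X < Y) (hY : 11.5 ≤ Real.log Y)
    (hrel : X ^ m * (Y - 1) + X = (X - 1) * Y ^ n + Y)
    (hlt : (m : ℝ) * Real.log X ≤ n * Real.log Y)
    (hlt' : ((n : ℝ) - 1) * Real.log Y < m * Real.log X)
    (hm : 4e11 * Real.log Y ^ 2 ≤ m) : False := by
  have hX' : (2 : ℝ) ≤ X := by exact_mod_cast hX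
  have hXY' : (X : ℝ) < Y := by exact_mod_cast hXY
  have hY2 : 2 ≤ Y := by omega
  have hl2 := Real.log_two_gt_d9
  have hL1 : Real.log 2 ≤ Real.log X := Real.log_le_log (by norm_num) hX'
  have hL12 : Real.log X ≤ Real.log Y := Real.log_le_log (by linarith) hXY'.le
  have hrelR : (X : ℝ) ^ m * ((Y : ℝ) - 1) + X = ((X : ℝ) - 1) * (Y : ℝ) ^ n + Y := by
    have := congrArg (Nat.cast (R := ℝ)) hrel
    push_cast [Nat.cast_sub (show 1 ≤ Y by omega), Nat.cast_sub (show 1 ≤ X by omega)] at this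
    exact this
  have hnm : n ≤ m := by
    have : ((n : ℝ) - 1) < m := by
      by_contra! h
      have h1 : (m : ℝ) * Real.log X ≤ (m : ℝ) * Real.log Y := by gcongr
      have h2 : (m : ℝ) * Real.log Y ≤ ((n : ℝ) - 1) * Real.log Y := by
        gcongr
      linarith
    have h3 : (n : ℝ) < m + 1 := by linarith
    have h4 : n < m + 1 := by exact_mod_cast h3
    omega
  have hcop := coprime_of_pow_mul_add_eq hX hXY hrel hnm hlt hm
  set L₁ := Real.log X with hL₁
  set L₂ := Real.log Y with hL₂
  obtain ⟨p, q, hppos, hqpos, hqQ, hτ⟩ :=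
    exists_small_linear_combination (L₁ := L₁) (L₂ := L₂) (by linarith) (by linarith)
  obtain ⟨hτ1, hτ2⟩ := abs_le.mp hτ
  have hp1 : (1 : ℝ) ≤ p := by exact_mod_cast hppos
  obtain ⟨u, hu₀⟩ : ∃ u : ℝ, u = q * L₁ := ⟨_, rfl⟩
  have hu : L₂ - 2.5e-10 ≤ u := by
    have : 1 * L₂ ≤ p * L₂ := by gcongr
    linarith
  obtain ⟨I, hI1, hI2⟩ : ∃ I : ℕ, 6 * q * I ≤ m ∧ m < 6 * q * (I + 1) :=
    ⟨m / (6 * q), Nat.mul_div_le m (6 * q), Nat.lt_mul_div_succ m (by omega)⟩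
  obtain ⟨J, hJ1, hJ2⟩ : ∃ J : ℕ, (J : ℝ) ≤ u ∧ u < J + 1 :=
    ⟨⌊u⌋₊, Nat.floor_le (by linarith), Nat.lt_floor_add_one u⟩
  obtain ⟨d, hd1, hd2⟩ : ∃ d : ℕ, 3 * d ≤ (I - 1) * J ∧ (I - 1) * J ≤ 3 * d + 2 :=
    ⟨(I - 1) * J / 3, by omega, by omega⟩
  have hI1R : 6 * q * I ≤ (m : ℝ) := by exact_mod_cast hI1
  have hI2R : (m : ℝ) < 6 * q * (I + 1) := by exact_mod_cast hI2
  have hI16 : 16 * L₂ ≤ I := by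
    by_contra! h
    have h1 : (q : ℝ) ≤ 4.1e9 * L₂ := by linarith
    have h2 : (I : ℝ) + 1 ≤ 16.1 * L₂ := by linarith
    have h3 : 6 * (q : ℝ) * (I + 1) ≤ 6 * (4.1e9 * L₂) * (16.1 * L₂) := by gcongr
    linarith only [h3, hm, hI2R, sq_nonneg L₂]
  have hI184 : (184 : ℝ) ≤ I := by linarith
  have hI184' : 184 ≤ I := by exact_mod_cast hI184
  have hJ11 : 11 ≤ J := by
    have : (10 : ℝ) < J := by linarith
    have : 10 < J := by exact_mod_cast this
    omega
  have hJ11R : (11 : ℝ) ≤ J := by exact_mod_cast hJ11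
  have hd1R : 3 * (d : ℝ) ≤ (I - 1) * J := by
    have := (Nat.cast_le (α := ℝ)).mpr hd1
    push_cast [Nat.cast_sub (show 1 ≤ I by omega)] at this
    exact this
  have hd2R : ((I : ℝ) - 1) * J ≤ 3 * d + 2 := by
    have := (Nat.cast_le (α := ℝ)).mpr hd2
    push_cast [Nat.cast_sub (show 1 ≤ I by omega)] at this
    exact this
  have hIJ11 : 11 * (I : ℝ) ≤ I * J := by
    have := mul_le_mul_of_nonneg_left hJ11R (Nat.cast_nonneg (α := ℝ) I)
    linarith only [this]
  have hIJ184 : 184 * (J : ℝ) ≤ I * J := by gcongr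
  have hIu : (I : ℝ) * u ≤ I * J * (12 / 11) := by
    have : u ≤ J * (12 / 11) := by linarith
    calc (I : ℝ) * u ≤ I * (J * (12 / 11)) := by gcongr
      _ = _ := by ring
  have hIJ0 : (I : ℝ) * J ≤ I * u := by gcongr
  have hmL1 : (m : ℝ) * L₁ ≤ 6 * u * (I + 1) := by
    calc (m : ℝ) * L₁ ≤ (6 * q * (I + 1)) * L₁ := by gcongr
      _ = _ := by rw [hu₀]; ring
  have hmL2 : 6 * (I * u) ≤ (m : ℝ) * L₁ := by
    calc 6 * (I * u) = (6 * q * I) * L₁ := by rw [hu₀]; ring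
      _ ≤ _ := by gcongr
  obtain ⟨k, hk1, hk2⟩ : ∃ k : ℕ → ℕ, (∀ j, q * k j ≤ j * m) ∧ ∀ j, j * m < q * (k j + 1) :=
    ⟨fun j => j * m / q, fun j => Nat.mul_div_le _ _, fun j => Nat.lt_mul_div_succ _ hqpos⟩
  have hX0 : (0 : ℝ) < X := by linarith
  have hY0 : (0 : ℝ) < Y := by linarith
  have hX1 : (0 : ℝ) < (X : ℝ) - 1 := by linarith
  have hY1 : (0 : ℝ) < (Y : ℝ) - 1 := by linarith
  have hα : Real.log ((X : ℝ) ^ q / (Y : ℝ) ^ p) = q * L₁ - p * L₂ := by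
    rw [Real.log_div (by positivity) (by positivity), Real.log_pow, Real.log_pow]
  obtain ⟨B, hB⟩ : ∃ B : ℕ, B = p * I + ⌈(n : ℝ) * 2.5e-10⌉₊ := ⟨_, rfl⟩
  have hρ : (X : ℝ) ^ m * ((Y : ℝ) - 1) / (((X : ℝ) - 1) * (Y : ℝ) ^ n) - 1
      = ((Y : ℝ) - X) / (((X : ℝ) - 1) * (Y : ℝ) ^ n) := by
    rw [div_sub_one (by positivity)]
    congr 1
    linarith
  have hYn : Real.exp (-(n * L₂)) = 1 / (Y : ℝ) ^ n := by
    rw [Real.exp_neg, Real.exp_nat_mul, Real.exp_log hY0, one_div]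
  refine no_small_denominators (I := I) (J := J) (d := d) (k := k)
    (α := (X : ℝ) ^ q / (Y : ℝ) ^ p)
    (ρ := (X : ℝ) ^ m * ((Y : ℝ) - 1) / (((X : ℝ) - 1) * (Y : ℝ) ^ n))
    (D := (X : ℝ) ^ q * (Y : ℝ) ^ B * ((Y : ℝ) - 1) ^ J)
    ?_ (by positivity) ?_ (by rwa [hα]) ?_ ?_ ?_ hd1 ?_ ?_ (by positivity) ?_ ?_
  · have : (100 : ℝ) ≤ d := by linarith
    exact_mod_cast this
  · intro h
    rw [div_eq_one_iff_eq (by positivity)] at h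
    have h' : X ^ q = Y ^ p := by exact_mod_cast h
    have h2 : (X ^ q).Coprime (Y ^ p) := hcop.pow q p
    rw [← h', Nat.coprime_self] at h2
    have := Nat.one_lt_pow hqpos.ne' (show 1 < X by omega)
    omega
  · rw [← sub_nonneg, hρ]
    have : (0 : ℝ) ≤ (Y : ℝ) - X := by linarith
    positivity
  · rw [hρ]
    have h1 : (n : ℝ) * L₂ - L₂ ≥ 17.9 * d := by linarith
    calc ((Y : ℝ) - X) / (((X : ℝ) - 1) * (Y : ℝ) ^ n) ≤ Y / (1 * (Y : ℝ) ^ n) := by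
          gcongr
          · linarith
          · linarith
      _ = Real.exp L₂ * Real.exp (-(n * L₂)) := by
          rw [hYn, hL₂, Real.exp_log hY0]; ring
      _ ≤ Real.exp (-17.9 * d) := by
          rw [← Real.exp_add]
          apply Real.exp_le_exp.mpr
          linarith
  · have : (J : ℝ) ≤ d := by linarith
    exact_mod_cast this
  · intro j j' hj
    have h1 : I * q ≤ m := by linarith only [hI1, Nat.zero_le (q * I)]
    have h2 := hk1 j
    have h3 : (j + 1) * m ≤ j' * m := Nat.mul_le_mul_right m hj
    have h4 : q * (k j + I) < q * (k j' + 1) := by linarith only [hk2 j', h1, h2, h3]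
    have := Nat.lt_of_mul_lt_mul_left h4
    omega
  · intro i hi j hj
    have h1 : k j ≤ 6 * j * (I + 1) := by
      have h2 : q * k j ≤ q * (6 * j * (I + 1)) := by
        calc q * k j ≤ j * m := hk1 j
          _ ≤ j * (6 * q * (I + 1)) := by gcongr
          _ = _ := by ring
      exact Nat.le_of_mul_le_mul_left h2 hqpos
    have h3 : 6 * j * (I + 1) + 6 * (I + 1) ≤ 6 * J * (I + 1) := by
      have : 6 * (j + 1) * (I + 1) ≤ 6 * J * (I + 1) := by gcongr; omega
      linarith only [this]
    have h4 : i + k j ≤ 6 * J * (I + 1) := by omega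
    have h5 : (6 * J * (I + 1) : ℝ) ≤ 19 * d := by
      linarith only [hd2R, hIJ184, hJ11R]
    have h6 : 6 * J * (I + 1) ≤ 19 * d := by exact_mod_cast h5
    omega
  · have hB' : (B : ℝ) ≤ p * I + (n * 2.5e-10 + 1) := by
      rw [hB]
      push_cast
      gcongr
      exact (Nat.ceil_lt_add_one (by positivity)).le
    have hlog : Real.log ((X : ℝ) ^ q * (Y : ℝ) ^ B * ((Y : ℝ) - 1) ^ J)
        = u + B * L₂ + J * Real.log ((Y : ℝ) - 1) := by
      rw [Real.log_mul (by positivity) (by positivity), Real.log_mul (by positivity)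
        (by positivity), Real.log_pow, Real.log_pow, Real.log_pow, hu₀]
    rw [← Real.log_le_iff_le_exp (by positivity), hlog]
    have h1 : Real.log ((Y : ℝ) - 1) ≤ L₂ := Real.log_le_log hY1 (by linarith)
    have h2 : (J : ℝ) * Real.log ((Y : ℝ) - 1) ≤ J * (I / 16) := by gcongr; linarith
    have h3 : (B : ℝ) * L₂ ≤ (p * I + (n * 2.5e-10 + 1)) * L₂ := by gcongr
    have h4 : (p : ℝ) * L₂ * I ≤ (u + 2.5e-10) * I := by
      gcongr
      linarith
    have h5 : (n : ℝ) * L₂ ≤ 6 * u * (I + 1) + L₂ := by linarith only [hmL1, hlt']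
    linarith only [h2, h3, h4, h5, hIu, hJ2, hd2R, hIJ184, hIJ11, hI16, hJ11R, hY]
  · intro i hi j hj
    refine exists_int_eq_den_mul hX hY2 hj.le ?_ ?_
    · have := hk2 j
      linarith only [this, Nat.zero_le (q * i)]
    · have h1 : (q : ℝ) * k j ≤ j * m := by exact_mod_cast hk1 j
      have h2 : (p : ℝ) * k j ≤ n * j + n * 2.5e-10 := by
        have hpos : 0 < (q : ℝ) * L₂ := by positivity
        refine le_of_mul_le_mul_right ?_ hpos
        have hjJ : (j : ℝ) ≤ u := (by exact_mod_cast hj.le : (j : ℝ) ≤ J).trans hJ1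
        calc (p : ℝ) * k j * (q * L₂) = (p * L₂) * (q * k j) := by ring
          _ ≤ (p * L₂) * (j * m) := by gcongr
          _ ≤ (u + 2.5e-10) * (j * m) := by
              gcongr
              linarith
          _ = j * q * (m * L₁) + j * (m * 2.5e-10) := by rw [hu₀]; ring
          _ ≤ j * q * (n * L₂) + u * (m * 2.5e-10) := by gcongr
          _ = j * q * (n * L₂) + q * 2.5e-10 * (m * L₁) := by rw [hu₀]; ring
          _ ≤ j * q * (n * L₂) + q * 2.5e-10 * (n * L₂) := by gcongr
          _ = _ := by ring
      have h3 : (n : ℝ) * 2.5e-10 ≤ ⌈(n : ℝ) * 2.5e-10⌉₊ := Nat.le_ceil _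
      have h4 : p * k j ≤ n * j + ⌈(n : ℝ) * 2.5e-10⌉₊ := by
        have : (p : ℝ) * k j ≤ n * j + ⌈(n : ℝ) * 2.5e-10⌉₊ := by linarith
        exact_mod_cast this
      have h5 : p * i ≤ p * I := by gcongr
      rw [hB, mul_add]
      omega

/-- Numerical lower bound for `log 100001`. -/
theorem log_100001_gt : 11.5 < Real.log 100001 := by
  rw [Real.lt_log_iff_exp_lt (by norm_num)]
  have h : Real.exp 11.5 ^ 2 < 100001 ^ 2 := by
    rw [← Real.exp_nat_mul]
    norm_num
    rw [show (23 : ℝ) = ((23 : ℕ) : ℝ) * 1 by norm_num, Real.exp_nat_mul]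
    calc Real.exp 1 ^ 23 < 2.7182818286 ^ 23 := by
          gcongr; exact Real.exp_one_lt_d9
      _ < _ := by norm_num
  exact lt_of_pow_lt_pow_left₀ 2 (by norm_num) h

/-- Numerical upper bound for `log 100001`. -/
theorem log_100001_lt : Real.log 100001 < 12 := by
  rw [Real.log_lt_iff_lt_exp (by norm_num)]
  rw [show (12 : ℝ) = ((12 : ℕ) : ℝ) * 1 by norm_num, Real.exp_nat_mul]
  calc (100001 : ℝ) < 2.7182818283 ^ 12 := by norm_num
    _ < _ := by gcongr; exact Real.exp_one_gt_d9

theorem stmt15 (N x₁ m₁ x₂ m₂ : ℕ) (hN : 2 ≤ N)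
    (h₁ : IsNSol N x₁ m₁) (h₂ : IsNSol N x₂ m₂) (hx : x₁ < x₂) (hx₂ : 100001 ≤ x₂) :
    Real.log N / Real.log (1.5 * Real.exp 1 * (1 + Real.log N / Real.log 100001))
      < 1.69019e10 * Real.log x₁ * Real.log ((x₂ : ℝ) - 1) * Real.log x₂ := by
  obtain ⟨hX, hm2, hs₁⟩ := h₁
  obtain ⟨hY2, hn2, hs₂⟩ := h₂
  have hX' : (2 : ℝ) ≤ x₁ := by exact_mod_cast hX
  have hY' : (100001 : ℝ) ≤ x₂ := by exact_mod_cast hx₂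
  have hxx : (x₁ : ℝ) < x₂ := by exact_mod_cast hx
  have hN' : (2 : ℝ) ≤ N := by exact_mod_cast hN
  have e₁ : N * (x₁ - 1) + 1 = x₁ ^ m₁ := by
    rw [← hs₁]; simpa [Nat.sub_add_cancel (show 1 ≤ x₁ by omega)] using geom_sum_mul_add (x₁ - 1) m₁
  have e₂ : N * (x₂ - 1) + 1 = x₂ ^ m₂ := by
    rw [← hs₂]; simpa [Nat.sub_add_cancel (show 1 ≤ x₂ by omega)] using geom_sum_mul_add (x₂ - 1) m₂
  have hrel : x₁ ^ m₁ * (x₂ - 1) + x₁ = (x₁ - 1) * x₂ ^ m₂ + x₂ := by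
    rw [← e₁, ← e₂]
    obtain ⟨a, rfl⟩ := Nat.exists_eq_add_of_le (show 1 ≤ x₁ by omega)
    obtain ⟨b, rfl⟩ := Nat.exists_eq_add_of_le (show 1 ≤ x₂ by omega)
    simp only [Nat.add_sub_cancel_left]
    ring
  have hlt : x₁ ^ m₁ ≤ x₂ ^ m₂ := by
    rw [← e₁, ← e₂]
    gcongr
  have hNlt : N < x₁ ^ m₁ := by
    rw [← e₁]
    have : N * 1 ≤ N * (x₁ - 1) := by gcongr; omega
    omega
  have hpow : x₂ ^ (m₂ - 1) ≤ N := by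
    rw [← hs₂]
    exact Finset.single_le_sum (f := fun i => x₂ ^ i) (fun i _ => Nat.zero_le _)
      (Finset.mem_range.mpr (by omega))
  have hlt₁ : (m₁ : ℝ) * Real.log x₁ ≤ m₂ * Real.log x₂ := by
    rw [← Real.log_pow, ← Real.log_pow]
    exact Real.log_le_log (by positivity) (by exact_mod_cast hlt)
  have hNm : Real.log N < m₁ * Real.log x₁ := by
    rw [← Real.log_pow]
    exact Real.log_lt_log (by positivity) (by exact_mod_cast hNlt)
  have hpowR : ((m₂ : ℝ) - 1) * Real.log x₂ ≤ Real.log N := by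
    have : ((m₂ : ℝ) - 1) = ((m₂ - 1 : ℕ) : ℝ) := by
      rw [Nat.cast_sub (by omega)]; simp
    rw [this, ← Real.log_pow]
    exact Real.log_le_log (by positivity) (by exact_mod_cast hpow)
  have hL100 := log_100001_gt
  have hY : 11.5 < Real.log x₂ := hL100.trans_le (Real.log_le_log (by norm_num) hY')
  by_contra! hneg
  refine not_repunit_eq_of_long hX hx hY.le hrel hlt₁ (hpowR.trans_lt hNm) ?_
  set L₁ := Real.log x₁
  set L₂ := Real.log x₂
  set ℓ := Real.log N
  have hL1 : 0.69 < L₁ := by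
    have := Real.log_two_gt_d9
    have : Real.log 2 ≤ L₁ := Real.log_le_log (by norm_num) hX'
    linarith
  have hL3 : L₂ - 0.01 ≤ Real.log ((x₂ : ℝ) - 1) := by
    have h1 : L₂ - Real.log ((x₂ : ℝ) - 1) = Real.log (x₂ / (x₂ - 1)) := by
      rw [Real.log_div (by linarith) (by linarith)]
    have h2 := Real.log_le_sub_one_of_pos
      (show 0 < (x₂ : ℝ) / (x₂ - 1) from div_pos (by linarith) (by linarith))
    have h3 : (x₂ : ℝ) / (x₂ - 1) ≤ 1.01 := by
      rw [div_le_iff₀ (by linarith)]; linarith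
    linarith
  have hℓ0 : 0 < ℓ := Real.log_pos (by linarith)
  have hL120 : 0 < Real.log 100001 := by linarith
  have he := Real.exp_one_gt_d9
  have hC : 0 < 1.69019e10 * L₁ * Real.log ((x₂ : ℝ) - 1) * L₂ := by
    have : 0 < Real.log ((x₂ : ℝ) - 1) := by linarith
    have : 0 < L₂ := by linarith
    positivity
  have hC2 : 1.68e10 * L₁ * L₂ ^ 2 ≤ 1.69019e10 * L₁ * Real.log ((x₂ : ℝ) - 1) * L₂ := by
    have : 1.68e10 * L₂ ≤ 1.69019e10 * Real.log ((x₂ : ℝ) - 1) := by linarith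
    calc 1.68e10 * L₁ * L₂ ^ 2 = L₁ * (1.68e10 * L₂) * L₂ := by ring
      _ ≤ L₁ * (1.69019e10 * Real.log ((x₂ : ℝ) - 1)) * L₂ := by gcongr
      _ = _ := by ring
  have hC3 : 1.5e12 ≤ 1.68e10 * L₁ * L₂ ^ 2 := by
    calc (1.5e12 : ℝ) ≤ 1.68e10 * 0.69 * 11.5 ^ 2 := by norm_num
      _ ≤ _ := by gcongr
  set B := 1.5 * Real.exp 1 * (1 + ℓ / Real.log 100001) with hB
  have hBpos : 0 < B := by positivity
  have hmul : ∀ t, 0 < t → t ≤ Real.log B → 1.68e10 * L₁ * L₂ ^ 2 * t ≤ ℓ := by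
    intro t ht htB
    have h1 := (le_div_iff₀ (ht.trans_le htB)).mp hneg
    calc 1.68e10 * L₁ * L₂ ^ 2 * t ≤ (1.69019e10 * L₁ * Real.log ((x₂ : ℝ) - 1) * L₂)
          * Real.log B := by gcongr
      _ ≤ ℓ := h1
  have hℓ1 : 1.5e12 ≤ ℓ := by
    have := hmul 1 one_pos (by
      rw [Real.le_log_iff_exp_le hBpos, hB]
      have : 0 < ℓ / Real.log 100001 := by positivity
      nlinarith)
    linarith
  have hlogB : 26 ≤ Real.log B := by
    rw [Real.le_log_iff_exp_le hBpos]
    have h1 : 1.2e11 ≤ ℓ / Real.log 100001 := by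
      rw [le_div_iff₀ hL120]
      have := log_100001_lt
      linarith
    have h2 : 4.8e11 ≤ B := by
      calc (4.8e11 : ℝ) ≤ 1.5 * 2.7182818283 * (1 + 1.2e11) := by norm_num
        _ ≤ B := by rw [hB]; gcongr
    refine le_trans ?_ h2
    rw [show (26 : ℝ) = ((26 : ℕ) : ℝ) * 1 by norm_num, Real.exp_nat_mul]
    calc Real.exp 1 ^ 26 ≤ 2.7182818286 ^ 26 := by
          gcongr; exact Real.exp_one_lt_d9.le
      _ ≤ _ := by norm_num
  have h26 := hmul 26 (by norm_num) hlogB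
  have hfin : 4e11 * L₂ ^ 2 * L₁ ≤ m₁ * L₁ := by
    have : 0 ≤ L₁ * L₂ ^ 2 := by positivity
    nlinarith
  exact le_of_mul_le_mul_right hfin (by linarith)
end

section
/- Let N be an integer with N ≥ exp(exp(62.3752)), and let x_1 < x_2 < ⋯ be the first coordinates of all N-solutions. Then the sum of 1/x over all N-solutions (x, m) with x_1 < x < (log N)^3 is strictly less than 3.0919. -/
open Polynomial in
theorem eq_zero_of_shifted_vanishing {L : ℕ} (p : Fin L → ℚ[X]) {α : ℚ} (hα : 1 < α)
    (Z : Finset ℚ)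
    (hZ : ∀ z ∈ Z, ∃ η : ℚ, η ≠ 0 ∧ ∀ u < L,
      ∑ l, (p l).eval (z + u) * (α ^ u * η) ^ (l : ℕ) = 0)
    (hcard : ∑ l, (p l).natDegree < Z.card) : p = 0 := by
  classical
  by_contra hp
  let Λ := {l : Fin L // p l ≠ 0}
  let e : Fin (Fintype.card Λ) ≃ Λ := (Fintype.equivFin Λ).symm
  have hΛL : Fintype.card Λ ≤ L :=
    (Fintype.card_subtype_le (fun l : Fin L => p l ≠ 0)).trans_eq (Fintype.card_fin L)
  let W : Matrix (Fin (Fintype.card Λ)) (Fin (Fintype.card Λ)) ℚ[X] :=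
    Matrix.of fun j u => C ((α ^ ((e j : Fin L) : ℕ)) ^ (u : ℕ)) * taylor (u : ℚ) (p (e j))
  have hterm (σ : Equiv.Perm (Fin (Fintype.card Λ))) (j) : W (σ j) j ≠ 0 := by
    have h1 : (α ^ ((e (σ j) : Fin L) : ℕ)) ^ (j : ℕ) ≠ 0 := by positivity
    exact mul_ne_zero (C_ne_zero.2 h1) ((taylor_eq_zero _ _).not.2 (e (σ j)).2)
  have hdegterm (σ : Equiv.Perm (Fin (Fintype.card Λ))) (j) :
      (W (σ j) j).natDegree = (p (e (σ j))).natDegree := by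
    have h1 : (α ^ ((e (σ j) : Fin L) : ℕ)) ^ (j : ℕ) ≠ 0 := by positivity
    simp only [W, Matrix.of_apply]
    rw [natDegree_C_mul h1, natDegree_taylor]
  have hdegprod (σ : Equiv.Perm (Fin (Fintype.card Λ))) :
      (∏ j, W (σ j) j).natDegree = ∑ j, (p (e j)).natDegree := by
    rw [natDegree_prod _ _ (fun j _ => hterm σ j)]
    simp_rw [hdegterm]
    exact Equiv.sum_comp σ (fun j => (p (e j)).natDegree)
  have hcoeff : W.det.coeff (∑ j, (p (e j)).natDegree) =
      (∏ j, (p (e j)).leadingCoeff) *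
        (Matrix.vandermonde fun j => α ^ ((e j : Fin L) : ℕ)).det := by
    rw [Matrix.det_apply, Matrix.det_apply, finsetSum_coeff, Finset.mul_sum]
    refine Finset.sum_congr rfl fun σ _ => ?_
    rw [Polynomial.coeff_smul, mul_smul_comm]
    congr 1
    rw [← hdegprod σ, coeff_natDegree, leadingCoeff_prod,
      ← Equiv.prod_comp σ (fun j => (p (e j)).leadingCoeff), ← Finset.prod_mul_distrib]
    refine Finset.prod_congr rfl fun j _ => ?_
    simp [W, leadingCoeff_taylor, Matrix.vandermonde_apply, mul_comm]
  have hne : W.det ≠ 0 := by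
    intro h0
    rw [h0, coeff_zero] at hcoeff
    symm at hcoeff
    rcases mul_eq_zero.1 hcoeff with h | h
    · obtain ⟨j, -, hj⟩ := Finset.prod_eq_zero_iff.1 h
      exact (e j).2 (leadingCoeff_eq_zero.1 hj)
    · refine Matrix.det_vandermonde_ne_zero_iff.2 (fun i j hij => ?_) h
      have := pow_right_injective₀ (by linarith) hα.ne' hij
      exact e.injective (Subtype.ext (Fin.ext this))
  have hroot : ∀ z ∈ Z, z ∈ W.det.roots.toFinset := by
    intro z hz
    rw [Multiset.mem_toFinset, mem_roots hne, IsRoot.def]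
    obtain ⟨η, hη, hsum⟩ := hZ z hz
    rw [← coe_evalRingHom, RingHom.map_det]
    rw [← Matrix.exists_vecMul_eq_zero_iff]
    refine ⟨fun j => η ^ ((e j : Fin L) : ℕ), ?_, ?_⟩
    · intro h
      obtain ⟨l, hl⟩ : ∃ l, p l ≠ 0 := by
        by_contra! h'
        exact hp (funext h')
      have := congrFun h (e.symm ⟨l, hl⟩)
      simp [hη] at this
    · funext u
      have h1 := hsum u (u.2.trans_le hΛL)
      rw [Pi.zero_apply, ← h1, Matrix.vecMul, dotProduct]
      have h2 : ∑ l, (p l).eval (z + u) * (α ^ (u : ℕ) * η) ^ (l : ℕ) =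
          ∑ l : Λ, (p l).eval (z + u) * (α ^ (u : ℕ) * η) ^ ((l : Fin L) : ℕ) := by
        rw [← Finset.sum_subtype (Finset.univ.filter fun l => p l ≠ 0) (by simp)
          (fun l : Fin L => (p l).eval (z + u) * (α ^ (u : ℕ) * η) ^ (l : ℕ)),
          Finset.sum_filter_of_ne]
        rintro l - hl h0
        simp [h0] at hl
      rw [h2, ← Equiv.sum_comp e]
      refine Finset.sum_congr rfl fun j _ => ?_
      simp [W, taylor_eval]
      ring
  have h3 : Z.card ≤ W.det.natDegree :=
    (Finset.card_le_card hroot).trans ((Multiset.toFinset_card_le _).trans (card_roots' _))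
  have h4 : W.det.natDegree ≤ ∑ j, (p (e j)).natDegree := by
    rw [Matrix.det_apply]
    refine natDegree_sum_le_of_forall_le _ _ fun σ _ => ?_
    exact (natDegree_smul_le _ _).trans (hdegprod σ).le
  have h5 : ∑ j, (p (e j)).natDegree ≤ ∑ l, (p l).natDegree := by
    rw [Equiv.sum_comp e (fun l : Λ => (p l).natDegree)]
    rw [← Finset.sum_subtype (Finset.univ.filter fun l => p l ≠ 0) (by simp)
      (fun l => (p l).natDegree)]
    exact Finset.sum_le_sum_of_subset (Finset.filter_subset _ _)
  omega

theorem exists_submatrix_det_ne_zero {ι κ : Type*} [Fintype κ] [DecidableEq κ]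
    (B : ι → κ → ℚ) (h : ∀ c : κ → ℚ, (∀ i, ∑ j, B i j * c j = 0) → c = 0) :
    ∃ f : κ → ι, (Matrix.of fun i j => B (f i) j).det ≠ 0 := by
  classical
  have hspan : Submodule.span ℚ (Set.range B) = ⊤ := by
    by_contra hlt
    obtain ⟨φ, hφ, hle⟩ := Submodule.exists_le_ker_of_lt_top _ (lt_top_iff_ne_top.2 hlt)
    apply hφ
    have hc := h (fun j => φ (Pi.single j 1)) fun i => by
      have h1 : φ (B i) = 0 := hle (Submodule.subset_span ⟨i, rfl⟩)
      rw [← Finset.univ_sum_single (B i), map_sum] at h1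
      rw [← h1]
      refine Finset.sum_congr rfl fun j _ => ?_
      rw [← smul_eq_mul, ← map_smul, ← Pi.single_smul, smul_eq_mul, mul_one]
    refine LinearMap.pi_ext' fun j => LinearMap.ext_ring ?_
    simpa using congrFun hc j
  obtain ⟨κ', a, ha, hsp, hli⟩ := exists_linearIndependent' ℚ B
  rw [hspan] at hsp
  let b := Module.Basis.mk hli hsp.ge
  let e : κ ≃ κ' := (Pi.basisFun ℚ κ).indexEquiv b
  refine ⟨fun i => a (e i), ?_⟩
  have := (hli.comp e e.injective)
  have h2 := Matrix.linearIndependent_rows_iff_isUnit.1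
    (show LinearIndependent ℚ (Matrix.of fun i j => B (a (e i)) j).row from this)
  exact ((Matrix.isUnit_iff_isUnit_det _).1 h2).ne_zero

theorem pow_dvd_det_mul {R κ ρ : Type*} [CommRing R] [Fintype κ] [DecidableEq κ] [Fintype ρ]
    (P : Matrix κ ρ R) (Q : Matrix ρ κ R) (x : R) (w : ρ → ℕ)
    (hQ : ∀ r c, x ^ w r ∣ Q r c) (W : ℕ)
    (hW : ∀ f : κ → ρ, Function.Injective f → W ≤ ∑ i, w (f i)) : x ^ W ∣ (P * Q).det := by
  classical
  have hrow : (P * Q).det = ∑ f : κ → ρ, Matrix.detRowAlternating (fun i => P i (f i) • Q (f i)) := by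
    have := (Matrix.detRowAlternating (R := R) (n := κ)).toMultilinearMap.map_sum
      (fun i r => P i r • Q r)
    refine Eq.trans ?_ this
    change Matrix.detRowAlternating (P * Q) = Matrix.detRowAlternating _
    congr 1
    funext i j
    simp [Matrix.mul_apply, Finset.sum_apply]
  rw [hrow]
  refine Finset.dvd_sum fun f _ => ?_
  rw [AlternatingMap.map_smul_univ]
  refine Dvd.dvd.mul_left ?_ _
  by_cases hf : Function.Injective f
  · choose T hT using hQ
    have : (fun i => Q (f i)) = fun i => x ^ w (f i) • T (f i) := by
      funext i j
      simp [hT]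
    rw [this, AlternatingMap.map_smul_univ, Finset.prod_pow_eq_pow_sum]
    exact Dvd.dvd.mul_right (pow_dvd_pow _ (hW f hf)) _
  · have h0 : Matrix.detRowAlternating (fun i => Q (f i)) = 0 := by
      obtain ⟨i, j, hij, hne⟩ : ∃ i j, f i = f j ∧ i ≠ j := by
        simpa [Function.Injective] using hf
      exact AlternatingMap.map_eq_zero_of_eq _ _ (by simp [hij]) hne
    rw [h0]
    exact dvd_zero _

theorem sum_weights_ge {κ : Type*} [Fintype κ] {J m : ℕ} (hm : Fintype.card κ ≤ m)
    (f : κ → Fin J ⊕ κ) (hf : Function.Injective f) :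
    ∑ i ∈ Finset.range (Fintype.card κ), i ≤
      ∑ i, Sum.elim (fun j : Fin J => (j : ℕ)) (fun _ => m) (f i) := by
  classical
  set w : Fin J ⊕ κ → ℕ := Sum.elim (fun j : Fin J => (j : ℕ)) (fun _ => m) with hw
  set M := Fintype.card κ
  have h1 (i : κ) : ∑ t ∈ Finset.range M, (if t < w (f i) then 1 else 0) ≤ w (f i) := by
    rw [← Finset.card_filter]
    refine (Finset.card_le_card (t := Finset.range (w (f i))) ?_).trans (by simp)
    intro t; simp
  refine le_trans ?_ (Finset.sum_le_sum fun i _ => h1 i)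
  rw [Finset.sum_comm, ← Finset.sum_range_reflect]
  refine Finset.sum_le_sum fun t ht => ?_
  rw [Finset.mem_range] at ht
  rw [← Finset.card_filter]
  have h2 : (Finset.univ.filter fun i => ¬ t < w (f i)).card ≤ t + 1 := by
    rw [← Finset.card_range (t + 1)]
    refine Finset.card_le_card_of_injOn (fun i => w (f i)) ?_ ?_
    · intro i; simp
    · intro i hi j hj hij
      simp only [Finset.coe_filter, Finset.mem_univ, true_and, Set.mem_ofPred_eq] at hi hj
      apply hf
      rcases hfi : f i with a | a <;> rcases hfj : f j with b | b <;>
        simp [hw, hfi, hfj] at hi hj hij ⊢ <;> omega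
  have h3 := Finset.card_filter_add_card_filter_not (s := (Finset.univ : Finset κ)) (fun i => t < w (f i))
  rw [Finset.card_univ] at h3
  omega

theorem exists_binomial_coeffs {x β : ℤ} (hβ : x ∣ β - 1) (k : ℕ) :
    ∃ c : ℕ → ℤ, (∀ i, x ^ i ∣ x ^ k * c i) ∧
      ∀ ξ J : ℕ, ξ < J → (ξ : ℤ) ^ k * β ^ ξ = ∑ i ∈ Finset.range J, (ξ.choose i : ℤ) * c i := by
  induction k with
  | zero =>
    refine ⟨fun i => (β - 1) ^ i, fun i => by simpa using pow_dvd_pow_of_dvd hβ i, fun ξ J h => ?_⟩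
    rw [pow_zero, one_mul]
    nth_rewrite 1 [show β = (β - 1) + 1 by ring]
    rw [add_pow]
    simp only [one_pow, mul_one]
    rw [Finset.sum_subset (Finset.range_subset_range.2 (Nat.succ_le_of_lt h))]
    · exact Finset.sum_congr rfl fun i _ => mul_comm _ _
    · intro i _ hi
      rw [Nat.choose_eq_zero_of_lt (by simpa using hi)]
      simp
  | succ k ih =>
    obtain ⟨c, hc, hsum⟩ := ih
    refine ⟨fun i => i * (c i + if i = 0 then 0 else c (i - 1)), fun i => ?_, fun ξ J h => ?_⟩
    · rcases i with _ | i
      · simp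
      · have h1 : x ^ (i + 1) ∣ x * (x ^ k * c (i + 1)) := Dvd.dvd.mul_left (hc _) _
        have h2 : x ^ (i + 1) ∣ x * (x ^ k * c i) := by
          rw [pow_succ']; exact mul_dvd_mul_left _ (hc i)
        have := (dvd_add h1 h2).mul_left ((i : ℤ) + 1)
        refine this.trans (dvd_of_eq ?_)
        simp only [Nat.cast_add, Nat.cast_one, Nat.add_eq_zero_iff, one_ne_zero, and_false,
          if_false, Nat.add_sub_cancel]
        ring
    · rw [pow_succ', mul_assoc, hsum ξ J h, Finset.mul_sum]
      obtain ⟨J, rfl⟩ : ∃ J', J = J' + 1 := ⟨J - 1, by omega⟩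
      have hrec (i : ℕ) : (ξ : ℤ) * ξ.choose i = i * ξ.choose i + (i + 1) * ξ.choose (i + 1) := by
        have := Nat.choose_succ_right_eq ξ i
        have h' : ((ξ.choose (i + 1) : ℕ) : ℤ) * (i + 1) = ξ.choose i * ((ξ : ℤ) - i) := by
          rcases le_or_gt i ξ with hi | hi
          · rw [← Nat.cast_sub hi]; exact_mod_cast this
          · rw [Nat.choose_eq_zero_of_lt hi, Nat.choose_eq_zero_of_lt (by omega)]; simp
        linarith
      have e1 : ∀ i, (ξ : ℤ) * (ξ.choose i * c i) =
          i * ξ.choose i * c i + (i + 1) * ξ.choose (i + 1) * c i := fun i => by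
        rw [← mul_assoc, hrec]; ring
      simp_rw [e1, mul_add, Finset.sum_add_distrib]
      congr 1
      · exact Finset.sum_congr rfl fun i _ => by ring
      · rw [Finset.sum_range_succ, Finset.sum_range_succ' _ J]
        rw [Nat.choose_eq_zero_of_lt (show ξ < J + 1 by omega)]
        simp
        exact Finset.sum_congr rfl fun i _ => by ring

open Polynomial in
theorem exists_interpolation_det_ne_zero {K L T S q : ℕ} (hT : T ≤ q)
    (hcount : (K - 1) * L < T * S) {α : ℤ} (hα : 1 < α) (θ : ℕ → ℤ) (hθ : ∀ s, θ s ≠ 0) :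
    ∃ f : Fin K × Fin L → Fin (T + L) × Fin S,
      (Matrix.of fun i j : Fin K × Fin L =>
        ((((f i).1 : ℕ) + ((f i).2 : ℕ) * q : ℕ) : ℤ) ^ (j.1 : ℕ) *
          (α ^ ((f i).1 : ℕ) * θ (f i).2) ^ (j.2 : ℕ)).det ≠ 0 := by
  classical
  have hα' : (1 : ℚ) < α := by exact_mod_cast hα
  obtain ⟨f, hf⟩ := exists_submatrix_det_ne_zero (ι := Fin (T + L) × Fin S) (κ := Fin K × Fin L)
    (fun i j => (((i.1 : ℕ) + (i.2 : ℕ) * q : ℕ) : ℚ) ^ (j.1 : ℕ) *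
          ((α : ℚ) ^ (i.1 : ℕ) * θ i.2) ^ (j.2 : ℕ)) (by
    intro c hc
    let p : Fin L → ℚ[X] := fun l => ∑ k : Fin K, C (c (k, l)) * X ^ (k : ℕ)
    have hdeg (l) : (p l).natDegree ≤ K - 1 := by
      refine natDegree_sum_le_of_forall_le _ _ fun k _ => ?_
      exact (natDegree_C_mul_X_pow_le _ _).trans (by omega)
    let g : ℕ × ℕ → ℚ := fun i => ((i.1 + i.2 * q : ℕ) : ℚ)
    have hg : Set.InjOn g (Finset.range T ×ˢ Finset.range S : Finset (ℕ × ℕ)) := by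
      rintro ⟨a, s⟩ h1 ⟨a', s'⟩ h2 h
      simp only [Finset.coe_product, Finset.coe_range, Set.mem_prod, Set.mem_Iio] at h1 h2
      have h3 : a + s * q = a' + s' * q := by
        simp only [g] at h
        exact_mod_cast h
      have hq : 0 < q := by omega
      have ha : a = a' := by
        have := congrArg (· % q) h3
        simpa [Nat.mod_eq_of_lt (h1.1.trans_le hT), Nat.mod_eq_of_lt (h2.1.trans_le hT)] using this
      subst ha
      simpa [hq.ne'] using h3
    have hp := eq_zero_of_shifted_vanishing p hα'
      ((Finset.range T ×ˢ Finset.range S).image g) (by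
        intro z hz
        obtain ⟨⟨a, s⟩, has, rfl⟩ := Finset.mem_image.1 hz
        simp only [Finset.mem_product, Finset.mem_range] at has
        refine ⟨(α : ℚ) ^ a * θ s, mul_ne_zero (by positivity) (by exact_mod_cast hθ s),
          fun u hu => ?_⟩
        rw [← hc (⟨a + u, by omega⟩, ⟨s, has.2⟩), Fintype.sum_prod_type_right]
        refine Finset.sum_congr rfl fun l _ => ?_
        simp only [p, eval_finsetSum, eval_mul, eval_C, eval_pow, eval_X, g, Finset.sum_mul]
        refine Finset.sum_congr rfl fun k _ => ?_
        push_cast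
        ring) (by
        rw [Finset.card_image_of_injOn hg, Finset.card_product, Finset.card_range,
          Finset.card_range]
        refine lt_of_le_of_lt (Finset.sum_le_card_nsmul _ _ _ fun l _ => hdeg l) ?_
        simpa [mul_comm] using hcount)
    funext ⟨k, l⟩
    have h1 : (p l).coeff k = 0 := by rw [hp]; simp
    simpa [p, finsetSum_coeff, coeff_C_mul, coeff_X_pow, Fin.val_inj] using h1)
  refine ⟨f, fun h0 => hf ?_⟩
  have := congrArg (Int.cast : ℤ → ℚ) h0
  rw [Int.cast_det, Int.cast_zero] at this
  rw [← this]
  congr 1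
  ext i j
  simp

theorem abs_det_le_factorial_mul_prod {κ : Type*} [Fintype κ] [DecidableEq κ] (A : Matrix κ κ ℤ)
    (b : κ → ℤ) (h : ∀ i j, |A i j| ≤ b j) :
    |A.det| ≤ (Fintype.card κ).factorial * ∏ j, b j := by
  rw [Matrix.det_apply]
  refine (Finset.abs_sum_le_sum_abs _ _).trans ?_
  refine (Finset.sum_le_card_nsmul _ _ (∏ j, b j) fun σ _ => ?_).trans_eq ?_
  · have hsign : |((Equiv.Perm.sign σ : ℤˣ) : ℤ)| = 1 := by
      rcases Int.units_eq_one_or (Equiv.Perm.sign σ) with h | h <;> simp [h]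
    rw [Units.smul_def, smul_eq_mul, abs_mul, hsign, one_mul, Finset.abs_prod]
    exact Finset.prod_le_prod (fun _ _ => abs_nonneg _) fun j _ => h _ j
  · rw [Finset.card_univ, Fintype.card_perm, nsmul_eq_mul]

theorem interpolation_det_bound {K L T S q m : ℕ} (hT : T ≤ q)
    (hcount : (K - 1) * L < T * S) (hm : K * L ≤ m) {x : ℕ} {α P Q E : ℤ} {Ξ : ℕ}
    (hxpos : 0 < x) (hα : 1 < α) (hP : P ≠ 0) (hQ : Q ≠ 0)
    (hxα : (x : ℤ) ∣ α - 1) (hx : (x : ℤ) ^ m ∣ α ^ q * Q - P)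
    (hΞ : ∀ a s, a < T + L → s < S → a + s * q ≤ Ξ)
    (hE : ∀ a s, a < T + L → s < S → |α ^ a * (P ^ s * Q ^ (S - s))| ≤ E) :
    (x : ℤ) ^ (∑ i ∈ Finset.range (K * L), i) ≤
      (x : ℤ) ^ (L * ∑ k ∈ Finset.range K, k) *
        ((K * L).factorial * ((Ξ : ℤ) ^ (L * ∑ k ∈ Finset.range K, k) *
          E ^ (K * ∑ l ∈ Finset.range L, l))) := by
  classical
  obtain ⟨f, hf⟩ := exists_interpolation_det_ne_zero hT hcount hα
    (fun s => P ^ s * Q ^ (S - s)) (fun s => mul_ne_zero (pow_ne_zero _ hP) (pow_ne_zero _ hQ))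
  set A : Matrix (Fin K × Fin L) (Fin K × Fin L) ℤ := Matrix.of fun i j =>
    ((((f i).1 : ℕ) + ((f i).2 : ℕ) * q : ℕ) : ℤ) ^ (j.1 : ℕ) *
      (α ^ ((f i).1 : ℕ) * (P ^ ((f i).2 : ℕ) * Q ^ (S - ((f i).2 : ℕ)))) ^ (j.2 : ℕ) with hA
  have hcard : Fintype.card (Fin K × Fin L) = K * L := by simp
  let ξ : Fin K × Fin L → ℕ := fun i => ((f i).1 : ℕ) + ((f i).2 : ℕ) * q
  have hξ (i) : ξ i < Ξ + 1 := Nat.lt_succ_of_le (hΞ _ _ (f i).1.2 (f i).2.2)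
  have hsumk : ∑ j : Fin K × Fin L, (j.1 : ℕ) = L * ∑ k ∈ Finset.range K, k := by
    rw [Fintype.sum_prod_type_right]
    dsimp only
    rw [Finset.sum_const, Finset.card_univ, Fintype.card_fin,
      smul_eq_mul, Fin.sum_univ_eq_sum_range (fun k => k)]
  have hsuml : ∑ j : Fin K × Fin L, (j.2 : ℕ) = K * ∑ l ∈ Finset.range L, l := by
    rw [Fintype.sum_prod_type]
    dsimp only
    rw [Finset.sum_const, Finset.card_univ, Fintype.card_fin,
      smul_eq_mul, Fin.sum_univ_eq_sum_range (fun l => l)]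
  have hαl (l : ℕ) : (x : ℤ) ∣ α ^ l - 1 := hxα.trans (by simpa using sub_dvd_pow_sub_pow α 1 l)
  choose c hc hcsum using fun j : Fin K × Fin L =>
    exists_binomial_coeffs (hαl (j.2 : ℕ)) (j.1 : ℕ)
  have hdvd : (x : ℤ) ^ (∑ i ∈ Finset.range (K * L), i) ∣
      (∏ j : Fin K × Fin L, (x : ℤ) ^ (j.1 : ℕ)) * A.det := by
    rw [← Matrix.det_mul_row]
    let P' : Matrix (Fin K × Fin L) (Fin (Ξ + 1) ⊕ Fin K × Fin L) ℤ := Matrix.of fun i r =>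
      Sum.elim (fun n : Fin (Ξ + 1) => ((ξ i).choose n : ℤ)) (fun i' => if i = i' then 1 else 0) r
    let Q' : Matrix (Fin (Ξ + 1) ⊕ Fin K × Fin L) (Fin K × Fin L) ℤ := Matrix.of fun r j =>
      Sum.elim (fun n : Fin (Ξ + 1) => (x : ℤ) ^ (j.1 : ℕ) * c j n * Q ^ (S * (j.2 : ℕ)))
        (fun i => (x : ℤ) ^ (j.1 : ℕ) * (A i j -
          Q ^ (S * (j.2 : ℕ)) * ((ξ i : ℤ) ^ (j.1 : ℕ) * (α ^ (j.2 : ℕ)) ^ ξ i))) r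
    have hprod : (Matrix.of fun i j : Fin K × Fin L => (x : ℤ) ^ (j.1 : ℕ) * A i j) = P' * Q' := by
      ext i j
      rw [Matrix.mul_apply, Fintype.sum_sum_type]
      simp only [P', Q', Matrix.of_apply, Sum.elim_inl, Sum.elim_inr, ite_mul, one_mul, zero_mul,
        Finset.sum_ite_eq, Finset.mem_univ, if_true]
      rw [hcsum j (ξ i) (Ξ + 1) (hξ i), Finset.sum_range]
      rw [mul_sub, ← add_sub_assoc, add_comm, add_sub_assoc, eq_comm, add_eq_left, sub_eq_zero,
        Finset.mul_sum, Finset.mul_sum]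
      exact Finset.sum_congr rfl fun n _ => by ring
    rw [hprod]
    refine pow_dvd_det_mul P' Q' (x : ℤ)
      (Sum.elim (fun n : Fin (Ξ + 1) => (n : ℕ)) (fun _ => m)) ?_ _ fun g hg => ?_
    · rintro (n | i) j
      · exact Dvd.dvd.mul_right (hc j n) _
      · refine Dvd.dvd.mul_left ?_ _
        simp only [hA, Matrix.of_apply, Sum.elim_inr]
        have h1 : (x : ℤ) ^ m ∣ (α ^ q * Q) ^ ((f i).2 : ℕ) - P ^ ((f i).2 : ℕ) :=
          hx.trans (sub_dvd_pow_sub_pow _ _ _)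
        have h2 : (x : ℤ) ^ m ∣ α ^ ((f i).1 : ℕ) * (P ^ ((f i).2 : ℕ) * Q ^ (S - ((f i).2 : ℕ))) -
            Q ^ S * α ^ ξ i := by
          have hS : Q ^ S = Q ^ ((f i).2 : ℕ) * Q ^ (S - ((f i).2 : ℕ)) := by
            rw [← pow_add, Nat.add_sub_cancel' (f i).2.2.le]
          have := h1.mul_left (-(α ^ ((f i).1 : ℕ) * Q ^ (S - ((f i).2 : ℕ))))
          refine this.trans (dvd_of_eq ?_)
          rw [hS]
          simp only [ξ, pow_add, pow_mul, mul_pow, mul_comm ((f i).2 : ℕ) q]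
          ring
        have h3 := (h2.trans (sub_dvd_pow_sub_pow _ _ (j.2 : ℕ))).mul_left ((ξ i : ℤ) ^ (j.1 : ℕ))
        refine h3.trans (dvd_of_eq ?_)
        rw [mul_pow (Q ^ S), ← pow_mul Q, ← pow_mul α, ← pow_mul α, mul_comm (ξ i)]
        ring
    · have := sum_weights_ge (hcard.trans_le hm) g hg
      rwa [hcard] at this
  rw [Finset.prod_pow_eq_pow_sum, hsumk] at hdvd
  have hxpos' : (0 : ℤ) < (x : ℤ) := by exact_mod_cast hxpos
  have hle := Int.le_of_dvd (by positivity) (((dvd_abs _ _).2 hdvd))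
  rw [abs_mul, abs_of_nonneg (by positivity)] at hle
  refine hle.trans (mul_le_mul_of_nonneg_left ?_ (by positivity))
  refine (abs_det_le_factorial_mul_prod A
    (fun j => (Ξ : ℤ) ^ (j.1 : ℕ) * E ^ (j.2 : ℕ)) fun i j => ?_).trans_eq ?_
  · simp only [hA, Matrix.of_apply]
    rw [abs_mul, abs_pow, abs_pow, Nat.abs_cast]
    gcongr
    · exact hΞ _ _ (f i).1.2 (f i).2.2
    · exact hE _ _ (f i).1.2 (f i).2.2
  · rw [hcard, Finset.prod_mul_distrib, Finset.prod_pow_eq_pow_sum, Finset.prod_pow_eq_pow_sum,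
      hsumk, hsuml]

theorem IsNSol.pow_eq {N x m : ℕ} (h : IsNSol N x m) : (x : ℤ) ^ m = N * ((x : ℤ) - 1) + 1 := by
  have := geom_sum_mul (x : ℤ) m
  rw [← h.2.2]
  push_cast
  linarith

theorem IsNSol.exponent_lt {N x y m n : ℕ} (hx : IsNSol N x m) (hy : IsNSol N y n) (hxy : x < y) :
    n < m := by
  by_contra! h
  have h1 : ∑ i ∈ Finset.range m, x ^ i ≤ ∑ i ∈ Finset.range n, x ^ i :=
    Finset.sum_le_sum_of_subset (Finset.range_subset_range.2 h)
  have h2 : ∑ i ∈ Finset.range n, x ^ i < ∑ i ∈ Finset.range n, y ^ i := by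
    refine Finset.sum_lt_sum (fun i _ => Nat.pow_le_pow_left hxy.le i) ⟨1, ?_, by simpa using hxy⟩
    exact Finset.mem_range.2 hy.2.1
  rw [hx.2.2] at h1
  rw [hy.2.2] at h2
  omega

theorem IsNSol.lt_pow {N x m : ℕ} (h : IsNSol N x m) : N < x ^ m := by
  have h1 := h.pow_eq
  have h2 : (2 : ℤ) ≤ x := by exact_mod_cast h.1
  have : (N : ℤ) < x ^ m := by nlinarith
  exact_mod_cast this

theorem IsNSol.pow_pred_le {N x m : ℕ} (h : IsNSol N x m) : x ^ (m - 1) ≤ N := by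
  rw [← h.2.2]
  exact Finset.single_le_sum (f := fun i => x ^ i) (fun _ _ => Nat.zero_le _)
    (Finset.mem_range.2 (by have := h.2.1; omega))

theorem IsNSol.cross_relation {N x y m n : ℕ} (hx : IsNSol N x m) (hy : IsNSol N y n) :
    (y : ℤ) ^ n * (1 - x) = y - x - (x : ℤ) ^ m * (y - 1) := by
  rw [hx.pow_eq, hy.pow_eq]
  ring

theorem IsNSol.gcd_pow_dvd {N x y m n : ℕ} (hx : IsNSol N x m) (hy : IsNSol N y n) (hxy : x < y) :
    x.gcd y ^ n ∣ y - x := by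
  have h1 : ((x.gcd y : ℕ) : ℤ) ^ n ∣ (x : ℤ) ^ m :=
    (pow_dvd_pow _ (hx.exponent_lt hy hxy).le).trans
      (pow_dvd_pow_of_dvd (by exact_mod_cast Nat.gcd_dvd_left x y) _)
  have h2 : ((x.gcd y : ℕ) : ℤ) ^ n ∣ (y : ℤ) ^ n :=
    pow_dvd_pow_of_dvd (by exact_mod_cast Nat.gcd_dvd_right x y) _
  have h3 := (h2.mul_right (1 - x)).add (h1.mul_right ((y : ℤ) - 1))
  rw [hx.cross_relation hy] at h3
  have h4 : ((x.gcd y ^ n : ℕ) : ℤ) ∣ ((y - x : ℕ) : ℤ) := by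
    rw [Nat.cast_sub hxy.le]
    push_cast
    simpa using h3
  exact_mod_cast h4

theorem IsNSol.exists_order {N x y m n : ℕ} (hx : IsNSol N x m) (hy : IsNSol N y n)
    (hc : x.Coprime y) :
    ∃ g : ℕ, 0 < g ∧ g ≤ x ∧ g ∣ n - 1 ∧ (x : ℤ) ∣ (y : ℤ) ^ g - 1 := by
  have : NeZero x := ⟨by have := hx.1; omega⟩
  let Y : (ZMod x)ˣ := ZMod.unitOfCoprime y hc.symm
  refine ⟨orderOf Y, orderOf_pos Y, ?_, ?_, ?_⟩
  · refine (orderOf_le_card_univ).trans ?_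
    rw [ZMod.card_units_eq_totient]
    exact Nat.totient_le x
  · rw [orderOf_dvd_iff_pow_eq_one]
    have h1 := congrArg (Int.cast : ℤ → ZMod x) (hx.cross_relation hy)
    push_cast at h1
    rw [ZMod.natCast_self, zero_pow (by have := hx.2.1; omega)] at h1
    have h2 : Y ^ n = Y := Units.ext (by simpa [Y] using h1)
    obtain ⟨k, rfl⟩ : ∃ k, n = k + 1 := ⟨n - 1, by have := hy.2.1; omega⟩
    rw [pow_succ] at h2
    simpa using h2
  · rw [← ZMod.intCast_zmod_eq_zero_iff_dvd]
    have h1 := congrArg (Units.val : (ZMod x)ˣ → ZMod x) (pow_orderOf_eq_one Y)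
    push_cast at h1 ⊢
    simpa [Y, sub_eq_zero] using h1

theorem IsNSol.interpolation_inequality {N x y m n g c L : ℕ} (hx : IsNSol N x m)
    (hy : IsNSol N y n) (hxy : x < y) (hg : 0 < g) (hgn : g ∣ n - 1)
    (hxg : (x : ℤ) ∣ (y : ℤ) ^ g - 1) (hc : 0 < c) (hL : 0 < L)
    (hm : g * c ^ 2 * L ^ 2 ≤ m) (hn : g * (c * L) ≤ n - 1) :
    (x : ℤ) ^ (∑ i ∈ Finset.range (g * c ^ 2 * L * L), i) ≤
      (x : ℤ) ^ (L * ∑ k ∈ Finset.range (g * c ^ 2 * L), k) *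
        ((g * c ^ 2 * L * L).factorial *
          (((c * L * (n + 1) : ℕ) : ℤ) ^ (L * ∑ k ∈ Finset.range (g * c ^ 2 * L), k) *
          ((y : ℤ) ^ (4 * (g * (c * L)))) ^ (g * c ^ 2 * L * ∑ l ∈ Finset.range L, l))) := by
  have hx2 := hx.1
  have hy1 : (1 : ℤ) ≤ y := by exact_mod_cast (show 1 ≤ y by omega)
  have hn2 := hy.2.1
  obtain ⟨q, hq⟩ := hgn
  have hTL : L ≤ c * L := Nat.le_mul_of_pos_left L hc
  have hpos : 0 < g * c ^ 2 * L := by positivity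
  refine interpolation_det_bound (T := c * L) (S := g * (c * L)) (q := q) (m := m)
    (α := (y : ℤ) ^ g) (P := y - x) (Q := y * (1 - x)) ?_ ?_ ?_ (by omega) ?_ ?_ ?_ hxg ?_ ?_ ?_
  · rw [hq] at hn
    exact Nat.le_of_mul_le_mul_left hn hg
  · calc (g * c ^ 2 * L - 1) * L < g * c ^ 2 * L * L := Nat.mul_lt_mul_of_pos_right (by omega) hL
      _ = c * L * (g * (c * L)) := by ring
  · calc g * c ^ 2 * L * L = g * c ^ 2 * L ^ 2 := by ring
      _ ≤ m := hm
  · exact one_lt_pow₀ (by exact_mod_cast (show 1 < y by omega)) hg.ne'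
  · have : (x : ℤ) < y := by exact_mod_cast hxy
    omega
  · refine mul_ne_zero (by omega) ?_
    have : (2 : ℤ) ≤ x := by exact_mod_cast hx2
    omega
  · have h1 := hx.cross_relation hy
    have h2 : (y : ℤ) ^ n = ((y : ℤ) ^ g) ^ q * y := by
      rw [← pow_mul, ← hq, ← pow_succ]
      congr 1
      omega
    refine ⟨-((y : ℤ) - 1), ?_⟩
    rw [h2] at h1
    linarith
  · intro a s ha hs
    have h1 : s * q ≤ c * L * (n - 1) := by
      calc s * q ≤ g * (c * L) * q := Nat.mul_le_mul_right _ hs.le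
        _ = c * L * (n - 1) := by rw [hq]; ring
    have h2 : c * L * (n + 1) = c * L * (n - 1) + 2 * (c * L) := by
      obtain ⟨k, rfl⟩ : ∃ k, n = k + 1 := ⟨n - 1, by omega⟩
      simp only [Nat.add_sub_cancel]
      ring
    omega
  · intro a s ha hs
    have hx1 : (x : ℤ) < y := by exact_mod_cast hxy
    have hx0 : (2 : ℤ) ≤ x := by exact_mod_cast hx2
    have hP : |(y : ℤ) - x| ≤ (y : ℤ) ^ 2 := by
      rw [abs_of_pos (by omega)]; nlinarith
    have hQ : |(y : ℤ) * (1 - x)| ≤ (y : ℤ) ^ 2 := by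
      rw [abs_mul, abs_of_pos (by omega), abs_of_neg (by omega)]; nlinarith
    calc |((y : ℤ) ^ g) ^ a * (((y : ℤ) - x) ^ s * (y * (1 - x)) ^ (g * (c * L) - s))|
        = (y : ℤ) ^ (g * a) * (|(y : ℤ) - x| ^ s * |(y : ℤ) * (1 - x)| ^ (g * (c * L) - s)) := by
          rw [abs_mul, abs_mul, abs_pow, abs_pow, abs_pow, abs_pow, ← pow_mul,
            abs_of_pos (show (0 : ℤ) < y by omega)]
      _ ≤ (y : ℤ) ^ (g * a) * (((y : ℤ) ^ 2) ^ s * ((y : ℤ) ^ 2) ^ (g * (c * L) - s)) := by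
          gcongr
      _ = (y : ℤ) ^ (g * a + 2 * (g * (c * L))) := by
          rw [← pow_add, Nat.add_sub_cancel' hs.le, ← pow_mul, ← pow_add]
      _ ≤ (y : ℤ) ^ (4 * (g * (c * L))) := by
          refine pow_le_pow_right₀ hy1 ?_
          have : g * a ≤ g * (2 * (c * L)) := Nat.mul_le_mul_left _ (by omega)
          linarith

theorem sum_range_id_cast (n : ℕ) : ((∑ i ∈ Finset.range n, i : ℕ) : ℝ) = n * (n - 1) / 2 := by
  induction n with
  | zero => simp
  | succ k ih =>
    rw [Finset.sum_range_succ, Nat.cast_add, ih]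
    push_cast
    ring

theorem IsNSol.lt_of_large_parameters {N x y m n g c L : ℕ} (hx : IsNSol N x m)
    (hy : IsNSol N y n) (hxy : x < y) (hg : 0 < g) (hgn : g ∣ n - 1)
    (hxg : (x : ℤ) ∣ (y : ℤ) ^ g - 1) (hc : 0 < c) (hL : 0 < L)
    (hm : g * c ^ 2 * L ^ 2 ≤ m) (hn : g * (c * L) ≤ n - 1)
    (hcu : 8 * Real.log y ≤ c * Real.log x) :
    L * Real.log x < 2 * (Real.log x + Real.log (c * L * (n + 1))) := by
  by_contra! hLu
  have hx2 := hx.1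
  have hineq := hx.interpolation_inequality hy hxy hg hgn hxg hc hL hm hn
  set M := g * c ^ 2 * L * L with hM
  have hMpos : 0 < M := by positivity
  have hineq' : (x : ℝ) ^ (∑ i ∈ Finset.range M, i) ≤
      (x : ℝ) ^ (L * ∑ k ∈ Finset.range (g * c ^ 2 * L), k) *
        ((M : ℝ) ^ M *
          (((c : ℝ) * L * (n + 1)) ^ (L * ∑ k ∈ Finset.range (g * c ^ 2 * L), k) *
          ((y : ℝ) ^ (4 * (g * (c * L)))) ^ (g * c ^ 2 * L * ∑ l ∈ Finset.range L, l))) := by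
    have h1 := (Int.cast_le (R := ℝ)).2 hineq
    push_cast at h1
    refine h1.trans ?_
    have h2 : ((M.factorial : ℕ) : ℝ) ≤ (M : ℝ) ^ M := by exact_mod_cast Nat.factorial_le_pow M
    gcongr
  have hx0 : (0 : ℝ) < x := by exact_mod_cast (show 0 < x by omega)
  have hy0 : (0 : ℝ) < y := by exact_mod_cast (show 0 < y by omega)
  have hM0 : (0 : ℝ) < M := by exact_mod_cast hMpos
  have hc1 : (1 : ℝ) ≤ c := by exact_mod_cast hc
  have hL1 : (1 : ℝ) ≤ L := by exact_mod_cast hL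
  have hg1 : (1 : ℝ) ≤ g := by exact_mod_cast hg
  have hn0 : (0 : ℝ) ≤ n := by positivity
  have hΞ1 : (1 : ℝ) ≤ c * L * (n + 1) :=
    one_le_mul_of_one_le_of_one_le (one_le_mul_of_one_le_of_one_le hc1 hL1) (by linarith)
  have hlog := Real.log_le_log (by positivity) hineq'
  rw [Real.log_mul (by positivity) (by positivity), Real.log_mul (by positivity) (by positivity),
    Real.log_mul (by positivity) (by positivity)] at hlog
  simp only [Real.log_pow] at hlog
  push_cast at hlog
  have s1 := sum_range_id_cast M
  have s2 := sum_range_id_cast (g * c ^ 2 * L)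
  have s3 := sum_range_id_cast L
  push_cast at s1 s2 s3
  rw [s1, s2, s3] at hlog
  have hMr : (M : ℝ) = g * c ^ 2 * L * L := by rw [hM]; push_cast; ring
  set u := Real.log x
  set v := Real.log y
  set X := Real.log (c * L * (n + 1))
  have hX : 0 ≤ X := Real.log_nonneg hΞ1
  have hv : 1 < v := by
    have h3 : (3 : ℝ) ≤ y := by exact_mod_cast (show 3 ≤ y by omega)
    rw [Real.lt_log_iff_exp_lt hy0]
    linarith [Real.exp_one_lt_d9]
  have hT1 : (1 : ℝ) ≤ g * (c * L) :=
    one_le_mul_of_one_le_of_one_le hg1 (one_le_mul_of_one_le_of_one_le hc1 hL1)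
  have hlogM : Real.log M ≤ 2 * (g * (c * L) - 1) := by
    have h1 : (M : ℝ) ≤ ((g : ℝ) * (c * L)) ^ 2 := by
      rw [hMr]
      have : (g : ℝ) ≤ g ^ 2 := by nlinarith
      calc (g : ℝ) * c ^ 2 * L * L = g * (c * L) ^ 2 := by ring
        _ ≤ (g : ℝ) ^ 2 * (c * L) ^ 2 := by gcongr
        _ = _ := by ring
    have h2 := Real.log_le_log hM0 h1
    rw [Real.log_pow] at h2
    have h3 := Real.log_le_sub_one_of_pos (show (0 : ℝ) < g * (c * L) by positivity)
    push_cast at h2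
    linarith
  have key : (M : ℝ) * ((M - 1) * u) ≤ M * ((g * c ^ 2 * L - 1) * (u + X) +
      (L - 1) * (4 * (g * (c * L))) * v + 2 * Real.log M) := by
    rw [hMr] at hlog ⊢
    linarith
  have key2 := le_of_mul_le_mul_left key hM0
  have hK : (0 : ℝ) ≤ g * c ^ 2 * L := by positivity
  have e1 := mul_le_mul_of_nonneg_left hLu hK
  have e2 := mul_le_mul_of_nonneg_left hcu (show (0 : ℝ) ≤ g * c * L * L by positivity)
  have e3 : (g : ℝ) * (c * L) ≤ g * (c * L) * v := le_mul_of_one_le_right (by positivity) hv.le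
  rw [hMr] at key2
  rw [hMr] at hlogM
  linarith

theorem exp_seven_mul_le_exp (t : ℝ) : 1096 * (t - 6) ≤ Real.exp t := by
  have h7 : (1096 : ℝ) ≤ Real.exp 7 := by
    have h1 : Real.exp 7 = Real.exp 1 ^ 7 := by rw [← Real.exp_nat_mul]; norm_num
    rw [h1]
    calc (1096 : ℝ) ≤ 2.7182818283 ^ 7 := by norm_num
      _ ≤ _ := pow_le_pow_left₀ (by norm_num) Real.exp_one_gt_d9.le 7
  have h2 : Real.exp t = Real.exp 7 * Real.exp (t - 7) := by rw [← Real.exp_add]; ring_nf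
  have h3 := Real.add_one_le_exp (t - 7)
  rcases le_total t 6 with h | h
  · linarith [Real.exp_pos t]
  · rw [h2]
    exact mul_le_mul h7 (by linarith) (by linarith) (by positivity)

theorem sq_le_exp_quarter {w : ℝ} (hw : 62.3752 ≤ w) : 961 * w ^ 2 ≤ Real.exp (w / 4) := by
  have h1 : 31 * w ≤ Real.exp (w / 8) := by linarith [exp_seven_mul_le_exp (w / 8)]
  have h2 : Real.exp (w / 4) = Real.exp (w / 8) ^ 2 := by
    rw [← Real.exp_nat_mul]; congr 1; push_cast; ring
  rw [h2]
  calc 961 * w ^ 2 = (31 * w) ^ 2 := by ring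
    _ ≤ _ := pow_le_pow_left₀ (by linarith) h1 2

theorem pow_four_le_exp {w : ℝ} (hw : 62.3752 ≤ w) :
    83521 * w ^ 4 ≤ Real.exp (0.45 * w) := by
  have h1 : 17 * w ≤ Real.exp (0.1125 * w) := by linarith [exp_seven_mul_le_exp (0.1125 * w)]
  have h2 : Real.exp (0.45 * w) = Real.exp (0.1125 * w) ^ 4 := by
    rw [← Real.exp_nat_mul]; congr 1; push_cast; ring
  rw [h2]
  calc 83521 * w ^ 4 = (17 * w) ^ 4 := by ring
    _ ≤ _ := pow_le_pow_left₀ (by linarith) h1 4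

theorem exists_interpolation_parameters {w u v : ℝ} (hw : 62.3752 ≤ w) (hu0 : 0.69 ≤ u)
    (hu : u ≤ 0.55 * w) (huv : u ≤ v) (hv : v ≤ 3 * w) :
    ∃ c L : ℕ, 0 < c ∧ 0 < L ∧ 8 * v ≤ c * u ∧ 2 * (u + 1.25 * w) ≤ L * u ∧
      2 * ((c : ℝ) * L) ≤ Real.exp (w / 4) ∧
      Real.exp (0.55 * w) * ((c : ℝ) * L) ^ 2 * u ≤ Real.exp w ∧
      3 * w * (Real.exp (0.55 * w) * (c * L) + 1) ≤ Real.exp w := by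
  have hup : 0 < u := by linarith
  have hc := Nat.le_ceil (8 * v / u)
  have hc' := Nat.ceil_lt_add_one (show 0 ≤ 8 * v / u by apply div_nonneg <;> linarith)
  have hL := Nat.le_ceil (2 * (u + 1.25 * w) / u)
  have hL' := Nat.ceil_lt_add_one
    (show 0 ≤ 2 * (u + 1.25 * w) / u by apply div_nonneg <;> linarith)
  have hcp : 0 < ⌈8 * v / u⌉₊ := Nat.ceil_pos.2 (div_pos (by linarith) hup)
  have hLp : 0 < ⌈2 * (u + 1.25 * w) / u⌉₊ := Nat.ceil_pos.2 (div_pos (by linarith) hup)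
  set c := ⌈8 * v / u⌉₊
  set L := ⌈2 * (u + 1.25 * w) / u⌉₊
  rw [div_le_iff₀ hup] at hc hL
  rw [← sub_lt_iff_lt_add, lt_div_iff₀ hup] at hc' hL'
  have hcu : c * u ≤ 24.55 * w := by linarith
  have hLu : L * u ≤ 4.15 * w := by linarith
  have hprod : (c * L : ℝ) * u ^ 2 ≤ 101.8825 * w ^ 2 := by
    calc (c * L : ℝ) * u ^ 2 = (c * u) * (L * u) := by ring
      _ ≤ (24.55 * w) * (4.15 * w) := by gcongr
      _ = _ := by ring
  have hcL0 : (0 : ℝ) ≤ c * L := by positivity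
  have hu2 : 0.476 ≤ u ^ 2 := by nlinarith
  have hcL : (c * L : ℝ) ≤ 215 * w ^ 2 := by nlinarith
  have hcL2 : (c * L : ℝ) ^ 2 * u ≤ 83521 * w ^ 4 := by
    have h1 : ((c * L : ℝ) ^ 2 * u) * 0.328 ≤ ((c * L : ℝ) ^ 2 * u) * u ^ 3 := by
      gcongr
      nlinarith
    have h2 : ((c * L : ℝ) ^ 2 * u) * u ^ 3 ≤ (101.8825 * w ^ 2) ^ 2 := by
      calc ((c * L : ℝ) ^ 2 * u) * u ^ 3 = ((c * L : ℝ) * u ^ 2) ^ 2 := by ring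
        _ ≤ _ := by gcongr
    nlinarith [show 0 ≤ w ^ 4 by positivity]
  have hE := pow_four_le_exp hw
  have hEq : Real.exp w = Real.exp (0.55 * w) * Real.exp (0.45 * w) := by
    rw [← Real.exp_add]; ring_nf
  have hE1 : 1 ≤ Real.exp (0.55 * w) := Real.one_le_exp (by linarith)
  refine ⟨c, L, hcp, hLp, hc, hL, ?_, ?_, ?_⟩
  · nlinarith [sq_le_exp_quarter hw]
  · rw [hEq, mul_assoc]
    gcongr
    linarith
  · have h3 : 3 * w * (215 * w ^ 2 + 1) ≤ 83521 * w ^ 4 := by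
      have : 0 ≤ w ^ 3 := by positivity
      nlinarith [sq_nonneg w]
    calc 3 * w * (Real.exp (0.55 * w) * (c * L) + 1)
        ≤ 3 * w * (Real.exp (0.55 * w) * (215 * w ^ 2) + Real.exp (0.55 * w)) := by gcongr
      _ = Real.exp (0.55 * w) * (3 * w * (215 * w ^ 2 + 1)) := by ring
      _ ≤ Real.exp (0.55 * w) * Real.exp (0.45 * w) := by gcongr; linarith
      _ = _ := hEq.symm

theorem IsNSol.log_lt {N x m : ℕ} (h : IsNSol N x m) (hN : 0 < N) :
    Real.log N < m * Real.log x := by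
  rw [← Real.log_pow]
  exact Real.log_lt_log (by exact_mod_cast hN) (by exact_mod_cast h.lt_pow)

theorem IsNSol.pred_mul_log_le {N x m : ℕ} (h : IsNSol N x m) :
    ((m : ℝ) - 1) * Real.log x ≤ Real.log N := by
  have h2 := h.2.1
  have hx := h.1
  have h1 : ((m - 1 : ℕ) : ℝ) = (m : ℝ) - 1 := by rw [Nat.cast_sub (by omega)]; simp
  rw [← h1, ← Real.log_pow]
  exact Real.log_le_log (by positivity) (by exact_mod_cast h.pow_pred_le)

/-- If two solutions have first coordinates `x < y < (log N) ^ 3`, then the smaller one already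
exceeds `(log N) ^ 0.55`. -/
theorem IsNSol.exp_lt_of_lt {N x y m n : ℕ} {w : ℝ} (hw : 62.3752 ≤ w)
    (hN : Real.log N = Real.exp w) (hx : IsNSol N x m) (hy : IsNSol N y n) (hxy : x < y)
    (hlt : (y : ℝ) < Real.log N ^ 3) : Real.exp (0.55 * w) < x := by
  have hx2 := hx.1
  have hn2 := hy.2.1
  have hx0 : (0 : ℝ) < x := by exact_mod_cast (show 0 < x by omega)
  have hy0 : (0 : ℝ) < y := by exact_mod_cast (show 0 < y by omega)
  have hN0 : 0 < N := by
    rcases Nat.eq_zero_or_pos N with h | h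
    · rw [h] at hN
      simp at hN
      exact absurd hN (Real.exp_pos w).ne
    · exact h
  by_contra! hle
  have hu : Real.log x ≤ 0.55 * w := by
    rw [← Real.log_exp (0.55 * w)]
    exact Real.log_le_log hx0 hle
  have hu0 : 0.69 ≤ Real.log x := by
    have h1 := Real.log_le_log (by norm_num) (show (2 : ℝ) ≤ x by exact_mod_cast hx2)
    linarith [Real.log_two_gt_d9]
  have huv : Real.log x ≤ Real.log y := Real.log_le_log hx0 (by exact_mod_cast hxy.le)
  have hv : Real.log y ≤ 3 * w := by
    have h1 := Real.log_le_log hy0 hlt.le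
    rw [hN, Real.log_pow, Real.log_exp] at h1
    exact_mod_cast h1
  have hv1 : 1 < Real.log y := by
    have h3 : (3 : ℝ) ≤ y := by exact_mod_cast (show 3 ≤ y by omega)
    rw [Real.lt_log_iff_exp_lt hy0]
    linarith [Real.exp_one_lt_d9]
  have hnl := hy.log_lt hN0
  have hnu := hy.pred_mul_log_le
  have hml := hx.log_lt hN0
  rw [hN] at hnl hnu hml
  have hn3 : Real.exp w < n * (3 * w) := hnl.trans_le (by gcongr)
  have hcop : x.Coprime y := by
    by_contra hne
    have hd : 2 ≤ x.gcd y := by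
      have := Nat.gcd_pos_of_pos_left y (show 0 < x by omega)
      have h1 : x.gcd y ≠ 1 := hne
      omega
    have h1 : 2 ^ n ≤ y - x :=
      (Nat.pow_le_pow_left hd n).trans (Nat.le_of_dvd (by omega) (hx.gcd_pow_dvd hy hxy))
    have h2 : (2 : ℝ) ^ n ≤ y := by exact_mod_cast h1.trans (Nat.sub_le y x)
    have h3 := Real.log_le_log (by positivity) h2
    rw [Real.log_pow] at h3
    have h4 : (n : ℝ) * 0.69 ≤ 3 * w := by
      refine le_trans ?_ (h3.trans hv)
      gcongr
      linarith [Real.log_two_gt_d9]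
    have h5 := pow_four_le_exp hw
    have h6 : Real.exp (0.45 * w) ≤ Real.exp w := Real.exp_le_exp.2 (by linarith)
    have h7 : 20 * w ^ 2 ≤ 83521 * w ^ 4 := by
      have : 1 ≤ w ^ 2 := by nlinarith
      nlinarith [mul_nonneg (sq_nonneg w) (sub_nonneg.2 this)]
    nlinarith
  obtain ⟨g, hg, hgx, hgn, hxg⟩ := hx.exists_order hy hcop
  obtain ⟨c, L, hc, hL, hcu, hLu, hcL, hcL2, hcL3⟩ :=
    exists_interpolation_parameters hw hu0 hu huv hv
  have hgE : (g : ℝ) ≤ Real.exp (0.55 * w) := le_trans (by exact_mod_cast hgx) hle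
  have hm' : g * c ^ 2 * L ^ 2 ≤ m := by
    have h1 : ((g : ℝ) * c ^ 2 * L ^ 2) * Real.log x < m * Real.log x := by
      refine lt_of_le_of_lt ?_ hml
      calc ((g : ℝ) * c ^ 2 * L ^ 2) * Real.log x = g * ((c : ℝ) * L) ^ 2 * Real.log x := by ring
        _ ≤ Real.exp (0.55 * w) * ((c : ℝ) * L) ^ 2 * Real.log x := by gcongr
        _ ≤ _ := hcL2
    have h2 := lt_of_mul_lt_mul_right h1 (by linarith)
    exact_mod_cast h2.le
  have hn' : g * (c * L) ≤ n - 1 := by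
    have h1 : (3 * w) * ((g : ℝ) * (c * L) + 1) < (3 * w) * n := by
      rw [mul_comm _ (n : ℝ)]
      refine lt_of_le_of_lt (le_trans ?_ hcL3) hn3
      gcongr
    have h2 := lt_of_mul_lt_mul_left h1 (by linarith)
    have h3 : g * (c * L) + 1 < n := by exact_mod_cast h2
    omega
  have hlast := hx.lt_of_large_parameters hy hxy hg hgn hxg hc hL hm' hn' hcu
  have hcL0 : (0 : ℝ) < c * L := by positivity
  have hE2 : 2 ≤ Real.exp w := by linarith [Real.add_one_le_exp w]
  have hnb : (n : ℝ) + 1 ≤ 2 * Real.exp w := by nlinarith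
  have hlog : Real.log (c * L * (n + 1)) ≤ 1.25 * w := by
    rw [← Real.log_exp (1.25 * w)]
    refine Real.log_le_log (by positivity) ?_
    calc (c : ℝ) * L * (n + 1) ≤ c * L * (2 * Real.exp w) := by gcongr
      _ = 2 * (c * L) * Real.exp w := by ring
      _ ≤ Real.exp (w / 4) * Real.exp w := by gcongr
      _ = Real.exp (1.25 * w) := by rw [← Real.exp_add]; ring_nf
  linarith

theorem IsNSol.le_pred_mul_log {N y n : ℕ} (h : IsNSol N y n) (hN : 0 < N) :
    Real.log N - 1 / ((y : ℝ) - 1) ≤ ((n : ℝ) - 1) * Real.log y := by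
  have hy : (2 : ℝ) ≤ y := by exact_mod_cast h.1
  have hN' : (0 : ℝ) < N := by exact_mod_cast hN
  have h1 : (y : ℝ) ^ n = N * ((y : ℝ) - 1) + 1 := by exact_mod_cast h.pow_eq
  have h2 : Real.log (N * ((y : ℝ) - 1)) ≤ Real.log ((y : ℝ) ^ n) :=
    Real.log_le_log (mul_pos hN' (by linarith)) (by linarith)
  rw [Real.log_mul hN'.ne' (by linarith), Real.log_pow] at h2
  have h3 : Real.log y - Real.log ((y : ℝ) - 1) ≤ 1 / ((y : ℝ) - 1) := by
    rw [← Real.log_div (by linarith) (by linarith)]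
    refine (Real.log_le_sub_one_of_pos (div_pos (by linarith) (by linarith))).trans (le_of_eq ?_)
    field_simp [show (y : ℝ) - 1 ≠ 0 by linarith]
    ring
  linarith

theorem log_sub_log_le {s t : ℝ} (hs : 0 < s) (ht : 0 < t) :
    Real.log t - Real.log s ≤ (t - s) / s := by
  rw [← Real.log_div ht.ne' hs.ne']
  refine (Real.log_le_sub_one_of_pos (div_pos ht hs)).trans (le_of_eq ?_)
  field_simp

theorem two_mul_div_le_log_sub_log {s t : ℝ} (hs : 0 < s) (hst : s ≤ t) :
    2 * (t - s) / (s + t) ≤ Real.log t - Real.log s := by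
  have ht : 0 < t := hs.trans_le hst
  rw [← Real.log_div ht.ne' hs.ne']
  have h := Real.le_log_one_add_of_nonneg (x := (t - s) / s) (div_nonneg (by linarith) hs.le)
  have e1 : 1 + (t - s) / s = t / s := by field_simp; ring
  have e2 : 2 * ((t - s) / s) / ((t - s) / s + 2) = 2 * (t - s) / (s + t) := by
    have : (t - s) / s + 2 = (s + t) / s := by field_simp; ring
    rw [this]
    field_simp
  rwa [e1, e2] at h

/-- Lower bound for the second divided difference of `1 / log`. -/
theorem le_divided_difference_inv_log {y₁ a b : ℝ} (hy : 1 < y₁) (ha : 1 ≤ a) (hb : 1 ≤ b) :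
    (a + b) / (4 * (y₁ + a) ^ 2 * Real.log y₁ * Real.log (y₁ + a)) ≤
      b / Real.log y₁ - (a + b) / Real.log (y₁ + a) + a / Real.log (y₁ + a + b) := by
  have h12 := two_mul_div_le_log_sub_log (s := y₁) (t := y₁ + a) (by linarith) (by linarith)
  have h23 := log_sub_log_le (s := y₁ + a) (t := y₁ + a + b) (by linarith) (by linarith)
  have m12 := Real.log_le_log (show 0 < y₁ by linarith) (show y₁ ≤ y₁ + a by linarith)
  have m23 := Real.log_le_log (show 0 < y₁ + a by linarith) (show y₁ + a ≤ y₁ + a + b by linarith)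
  have h1 : 0 < Real.log y₁ := Real.log_pos hy
  set l₁ := Real.log y₁
  set l₂ := Real.log (y₁ + a)
  set l₃ := Real.log (y₁ + a + b)
  have h2 : 0 < l₂ := by linarith
  have h3 : 0 < l₃ := by linarith
  have e : b / l₁ - (a + b) / l₂ + a / l₃ =
      b * (l₂ - l₁) / (l₁ * l₂) - a * (l₃ - l₂) / (l₂ * l₃) := by
    field_simp
    ring
  have s1 : b * (2 * (y₁ + a - y₁) / (y₁ + (y₁ + a))) / (l₁ * l₂) ≤
      b * (l₂ - l₁) / (l₁ * l₂) := by gcongr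
  have s2 : a * (l₃ - l₂) / (l₂ * l₃) ≤ a * ((y₁ + a + b - (y₁ + a)) / (y₁ + a)) / (l₂ * l₁) := by
    gcongr
    · exact mul_nonneg (by linarith) (div_nonneg (by linarith) (by linarith))
    · exact m12.trans m23
  have s3 : b * (2 * (y₁ + a - y₁) / (y₁ + (y₁ + a))) / (l₁ * l₂) -
      a * ((y₁ + a + b - (y₁ + a)) / (y₁ + a)) / (l₂ * l₁) =
      (a ^ 2 * b) / ((y₁ + a) * (2 * y₁ + a) * l₁ * l₂) := by
    have : y₁ + a ≠ 0 := by linarith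
    have : 2 * y₁ + a ≠ 0 := by linarith
    rw [show y₁ + (y₁ + a) = 2 * y₁ + a by ring]
    field_simp
    ring
  have s4 : (a + b) / (4 * (y₁ + a) ^ 2 * l₁ * l₂) ≤
      (a ^ 2 * b) / ((y₁ + a) * (2 * y₁ + a) * l₁ * l₂) := by
    have hab : a + b ≤ 2 * (a ^ 2 * b) := by
      have : 1 * (a * b) ≤ a * (a * b) := by gcongr
      nlinarith
    calc (a + b) / (4 * (y₁ + a) ^ 2 * l₁ * l₂)
        ≤ 2 * (a ^ 2 * b) / (4 * (y₁ + a) ^ 2 * l₁ * l₂) := by gcongr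
      _ = (a ^ 2 * b) / ((y₁ + a) * (2 * (y₁ + a)) * l₁ * l₂) := by
        have : y₁ + a ≠ 0 := by linarith
        field_simp
        norm_num
      _ ≤ _ := by gcongr; linarith
  rw [e]
  linarith

/-- Upper bound for the second divided difference of `1 / log`. -/
theorem divided_difference_inv_log_le {y₁ a b : ℝ} (hy : 1 < y₁) (ha : 0 ≤ a) (hb : 0 ≤ b) :
    b / Real.log y₁ - (a + b) / Real.log (y₁ + a) + a / Real.log (y₁ + a + b) ≤
      a * b * (a + b) * (1 + Real.log (y₁ + a + b)) /
        (Real.log y₁ * Real.log (y₁ + a) * Real.log (y₁ + a + b) * y₁ * (y₁ + a + b)) := by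
  have h12 := log_sub_log_le (s := y₁) (t := y₁ + a) (by linarith) (by linarith)
  have h13 := log_sub_log_le (s := y₁) (t := y₁ + a + b) (by linarith) (by linarith)
  have h23 := log_sub_log_le (s := y₁ + a + b) (t := y₁ + a) (by linarith) (by linarith)
  have m12 := Real.log_le_log (show 0 < y₁ by linarith) (show y₁ ≤ y₁ + a by linarith)
  have m23 := Real.log_le_log (show 0 < y₁ + a by linarith) (show y₁ + a ≤ y₁ + a + b by linarith)
  have h1 : 0 < Real.log y₁ := Real.log_pos hy
  set l₁ := Real.log y₁
  set l₂ := Real.log (y₁ + a)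
  set l₃ := Real.log (y₁ + a + b)
  have h2 : 0 < l₂ := by linarith
  have h3 : 0 < l₃ := by linarith
  have hy3 : 0 < y₁ + a + b := by linarith
  have hy0 : 0 < y₁ := by linarith
  have e : b / l₁ - (a + b) / l₂ + a / l₃ =
      b * (l₂ - l₁) / (l₁ * l₂) + a * (l₂ - l₃) / (l₂ * l₃) := by
    field_simp
    ring
  have s1 : b * (l₂ - l₁) / (l₁ * l₂) ≤ b * ((y₁ + a - y₁) / y₁) / (l₁ * l₂) := by gcongr
  have s2 : a * (l₂ - l₃) / (l₂ * l₃) ≤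
      a * ((y₁ + a - (y₁ + a + b)) / (y₁ + a + b)) / (l₂ * l₃) := by gcongr
  have s3 : b * ((y₁ + a - y₁) / y₁) / (l₁ * l₂) +
      a * ((y₁ + a - (y₁ + a + b)) / (y₁ + a + b)) / (l₂ * l₃) =
      a * b * ((a + b) * l₃ + y₁ * (l₃ - l₁)) / (l₁ * l₂ * l₃ * y₁ * (y₁ + a + b)) := by
    field_simp
    ring
  have s4 : y₁ * (l₃ - l₁) ≤ a + b := by
    rw [le_div_iff₀ hy0] at h13
    linarith
  rw [e]
  refine (add_le_add s1 s2).trans (s3.le.trans ?_)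
  have s5 : a * b * ((a + b) * l₃ + y₁ * (l₃ - l₁)) ≤ a * b * (a + b) * (1 + l₃) := by
    rw [mul_assoc (a * b)]
    gcongr
    linarith
  gcongr

theorem mul_one_div_lt_of_large {X w a b l₁ l₂ E : ℝ} (hw : 62 ≤ w) (hX : 1000 * w ≤ X)
    (ha : 0 < a) (hb : 0 < b) (hab : a + b < w) (h₁ : 0 < l₁) (h₂ : 0 < l₂) (hl : l₂ ≤ w)
    (hE : 8 * w * (X + a) ≤ E) :
    (a + b) * (1 / ((X - 1) * l₁)) < E * ((a + b) / (4 * (X + a) ^ 2 * l₁ * l₂)) := by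
  have hXa : 0 < X + a := by linarith
  have e1 : 8 * w * (X + a) * ((a + b) / (4 * (X + a) ^ 2 * l₁ * l₂)) ≤
      E * ((a + b) / (4 * (X + a) ^ 2 * l₁ * l₂)) := by gcongr
  refine lt_of_lt_of_le ?_ e1
  have e2 : 8 * w * (X + a) * ((a + b) / (4 * (X + a) ^ 2 * l₁ * l₂)) =
      (a + b) * (2 / ((X + a) * l₁) * (w / l₂)) := by
    field_simp
    norm_num
  rw [e2]
  have e3 : 1 ≤ w / l₂ := (one_le_div h₂).2 hl
  have e4 : 1 / ((X - 1) * l₁) < 2 / ((X + a) * l₁) := by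
    rw [← div_div, ← div_div]
    have : 1 / (X - 1) < 2 / (X + a) := by
      rw [div_lt_div_iff₀ (by linarith) hXa]
      linarith
    gcongr
  have e5 : 2 / ((X + a) * l₁) ≤ 2 / ((X + a) * l₁) * (w / l₂) :=
    le_mul_of_one_le_right (by positivity) e3
  exact mul_lt_mul_of_pos_left (e4.trans_le e5) (by linarith)

theorem exp_mul_divided_difference_bound_le {X w a b l₁ l₂ l₃ : ℝ} (hw : 62.3752 ≤ w)
    (hX : Real.exp (0.55 * w) ≤ X) (ha : 0 < a) (hb : 0 < b) (hab : a + b < w)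
    (h₁ : 0.55 * w ≤ l₁) (h₂ : 0.55 * w ≤ l₂) (h₃ : 0.55 * w ≤ l₃) :
    Real.exp w * (a * b * (a + b) * (1 + l₃) / (l₁ * l₂ * l₃ * X * (X + a + b))) ≤ 1 / 4 := by
  have hX0 : 0 < X := (Real.exp_pos _).trans_le hX
  have h1 : 0 < l₁ := by linarith
  have h2 : 0 < l₂ := by linarith
  have h3 : 0 < l₃ := by linarith
  have hw0 : 0 < w := by linarith
  rw [← mul_div_assoc, div_le_iff₀ (by positivity)]
  have e1 : 4 * w ≤ Real.exp (0.1 * w) := by linarith [exp_seven_mul_le_exp (0.1 * w)]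
  have e2 : a * b ≤ w ^ 2 / 4 := by
    have : (a + b) ^ 2 ≤ w ^ 2 := by gcongr
    linarith [sq_nonneg (a - b)]
  have e3 : Real.exp w * Real.exp (0.1 * w) = Real.exp (0.55 * w) * Real.exp (0.55 * w) := by
    rw [← Real.exp_add, ← Real.exp_add]; ring_nf
  calc Real.exp w * (a * b * (a + b) * (1 + l₃))
      ≤ Real.exp w * ((w ^ 2 / 4) * w * (1.03 * l₃)) := by gcongr; linarith
    _ ≤ Real.exp w * (1 / 4 * ((0.55 * w) * (0.55 * w) * l₃ * Real.exp (0.1 * w))) := by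
      refine mul_le_mul_of_nonneg_left ?_ (Real.exp_pos w).le
      have e4 := mul_le_mul_of_nonneg_left e1 (show 0 ≤ w ^ 2 * l₃ by positivity)
      have e5 : 0 ≤ w ^ 2 * l₃ * w := by positivity
      linarith
    _ = 1 / 4 * ((0.55 * w) * (0.55 * w) * l₃ * (Real.exp w * Real.exp (0.1 * w))) := by ring
    _ = 1 / 4 * ((0.55 * w) * (0.55 * w) * l₃ * Real.exp (0.55 * w) * Real.exp (0.55 * w)) := by
      rw [e3]; ring
    _ ≤ 1 / 4 * (l₁ * l₂ * l₃ * X * (X + a + b)) := by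
      gcongr
      linarith

/-- Three distinct first coordinates in a suitable range span an interval of length at least `w`. -/
theorem IsNSol.add_le_of_lt_of_lt {N x y z k m n : ℕ} {w : ℝ} (hw : 62.3752 ≤ w)
    (hN : Real.log N = Real.exp w) (hx : IsNSol N x k) (hy : IsNSol N y m) (hz : IsNSol N z n)
    (hxy : x < y) (hyz : y < z) (hxw : Real.exp (0.55 * w) ≤ x)
    (hzw : 8 * w * z ≤ Real.exp w) : (x : ℝ) + w ≤ z := by
  by_contra! hlt
  have hN0 : 0 < N := by
    have h1 := hx.2.1
    rw [← hx.2.2]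
    exact Finset.sum_pos (fun i _ => pow_pos (by have := hx.1; omega) i) ⟨0, by simp; omega⟩
  obtain ⟨a, rfl⟩ : ∃ a, y = x + a := ⟨y - x, by omega⟩
  obtain ⟨b, rfl⟩ : ∃ b, z = x + a + b := ⟨z - (x + a), by omega⟩
  have ha : (1 : ℝ) ≤ a := by exact_mod_cast (show 1 ≤ a by omega)
  have hb : (1 : ℝ) ≤ b := by exact_mod_cast (show 1 ≤ b by omega)
  have hX : 1000 * w ≤ x := by
    have h1 := pow_four_le_exp hw
    have h2 : Real.exp (0.45 * w) ≤ Real.exp (0.55 * w) := Real.exp_le_exp.2 (by linarith)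
    have h3 : 1 ≤ w ^ 3 := one_le_pow₀ (by linarith)
    nlinarith
  have fl := le_divided_difference_inv_log (y₁ := x) (by linarith) ha hb
  have fu := divided_difference_inv_log_le (y₁ := x) (a := a) (b := b) (by linarith) (by linarith)
    (by linarith)
  have u1 := hx.pred_mul_log_le
  have u2 := hy.pred_mul_log_le
  have u3 := hz.pred_mul_log_le
  have d1 := hx.le_pred_mul_log hN0
  have d2 := hy.le_pred_mul_log hN0
  have d3 := hz.le_pred_mul_log hN0
  rw [hN] at u1 u2 u3 d1 d2 d3
  push_cast at u1 u2 u3 d1 d2 d3 hlt hzw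
  have l1w : 0.55 * w ≤ Real.log x := by
    rw [← Real.log_exp (0.55 * w)]
    exact Real.log_le_log (Real.exp_pos _) hxw
  have m12 := Real.log_le_log (show (0 : ℝ) < x by linarith) (show (x : ℝ) ≤ x + a by linarith)
  have m23 := Real.log_le_log (show (0 : ℝ) < x + a by linarith)
    (show (x : ℝ) + a ≤ x + a + b by linarith)
  have l3w : Real.log ((x : ℝ) + a + b) ≤ w := by
    rw [← Real.log_exp w]
    refine Real.log_le_log (by linarith) (le_trans ?_ hzw)
    exact le_mul_of_one_le_left (by linarith) (by linarith)
  have hE : 8 * w * (x + a) ≤ Real.exp w := by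
    refine le_trans (mul_le_mul_of_nonneg_left ?_ (by linarith)) hzw
    linarith
  set l₁ := Real.log x
  set l₂ := Real.log ((x : ℝ) + a)
  set l₃ := Real.log ((x : ℝ) + a + b)
  have h1 : 0 < l₁ := by linarith
  have h2 : 0 < l₂ := by linarith
  have h3 : 0 < l₃ := by linarith
  set F := (b : ℝ) / l₁ - (a + b) / l₂ + a / l₃
  set ε := 1 / (((x : ℝ) - 1) * l₁)
  have hx1 : (0 : ℝ) < x - 1 := by linarith
  have hp : ∀ p l t : ℝ, l₁ ≤ l → (x : ℝ) ≤ t → p * l ≤ Real.exp w →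
      Real.exp w - 1 / (t - 1) ≤ p * l →
      p ≤ Real.exp w / l ∧ Real.exp w / l - ε ≤ p := by
    intro p l t hl ht hu hd
    have hl0 : 0 < l := by linarith
    refine ⟨(le_div_iff₀ hl0).2 hu, ?_⟩
    have h4 : Real.exp w / l - 1 / ((t - 1) * l) ≤ p := by
      rw [← div_div, ← sub_div, div_le_iff₀ hl0]
      exact hd
    have h5 : 1 / ((t - 1) * l) ≤ ε := by
      refine one_div_le_one_div_of_le (by positivity) ?_
      exact mul_le_mul (by linarith) hl h1.le (by linarith)
    linarith
  obtain ⟨p1u, p1d⟩ := hp _ l₁ x le_rfl le_rfl u1 d1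
  obtain ⟨p2u, p2d⟩ := hp _ l₂ (x + a) m12 (by linarith) u2 d2
  obtain ⟨p3u, p3d⟩ := hp _ l₃ (x + a + b) (by linarith) (by linarith) u3 d3
  have hεpos : 0 < ε := by positivity
  let D : ℤ := b * ((k : ℤ) - 1) - (a + b) * ((m : ℤ) - 1) + a * ((n : ℤ) - 1)
  have hD : (D : ℝ) = b * ((k : ℝ) - 1) - (a + b) * ((m : ℝ) - 1) + a * ((n : ℝ) - 1) := by
    simp [D]
  have hF : Real.exp w * F =
      b * (Real.exp w / l₁) - (a + b) * (Real.exp w / l₂) + a * (Real.exp w / l₃) := by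
    simp only [F]
    ring
  have q1 : (b : ℝ) * (Real.exp w / l₁ - ε) ≤ b * ((k : ℝ) - 1) := by gcongr
  have q1' : (b : ℝ) * ((k : ℝ) - 1) ≤ b * (Real.exp w / l₁) := by gcongr
  have q2 : ((a : ℝ) + b) * (Real.exp w / l₂ - ε) ≤ (a + b) * ((m : ℝ) - 1) := by gcongr
  have q2' : ((a : ℝ) + b) * ((m : ℝ) - 1) ≤ (a + b) * (Real.exp w / l₂) := by gcongr
  have q3 : (a : ℝ) * (Real.exp w / l₃ - ε) ≤ a * ((n : ℝ) - 1) := by gcongr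
  have q3' : (a : ℝ) * ((n : ℝ) - 1) ≤ a * (Real.exp w / l₃) := by gcongr
  have hDlo : Real.exp w * F - (a + b) * ε ≤ D := by rw [hD, hF]; linarith
  have hDhi : (D : ℝ) ≤ Real.exp w * F + (a + b) * ε := by rw [hD, hF]; linarith
  have hpos : (0 : ℝ) < D := by
    have g1 : ((a : ℝ) + b) * ε < Real.exp w * ((a + b) / (4 * (x + a) ^ 2 * l₁ * l₂)) :=
      mul_one_div_lt_of_large (by linarith) hX (by linarith) (by linarith) (by linarith) h1 h2
        (by linarith) hE
    have g2 := mul_le_mul_of_nonneg_left fl (Real.exp_pos w).le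
    linarith
  have hlt1 : (D : ℝ) < 1 := by
    have g1 : ((a : ℝ) + b) * ε ≤ 1 / 4 := by
      have : ((a : ℝ) + b) * ε = (a + b) / ((x - 1) * l₁) := by simp only [ε]; ring
      rw [this, div_le_iff₀ (by positivity)]
      have : (x : ℝ) - 1 ≤ (x - 1) * l₁ := le_mul_of_one_le_right hx1.le (by linarith)
      linarith
    have g2 := mul_le_mul_of_nonneg_left fu (Real.exp_pos w).le
    have g3 := exp_mul_divided_difference_bound_le (l₃ := l₃) hw hxw (a := a) (b := b)
      (by linarith) (by linarith) (by linarith) l1w (l1w.trans m12) (l1w.trans (m12.trans m23))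
    linarith
  have i1 : 0 < D := by exact_mod_cast hpos
  have i2 : D < 1 := by exact_mod_cast hlt1
  omega

/-- Reciprocal sum over a set meeting every block of length `h` in at most two elements. -/
theorem sum_one_div_le_of_three_spread (s : Finset ℕ) {h : ℕ} (hh : 0 < h) {J : ℕ}
    (hlo : ∀ x ∈ s, h ≤ x) (hhi : ∀ x ∈ s, x ≤ J)
    (hs : ∀ x ∈ s, ∀ y ∈ s, ∀ z ∈ s, x < y → y < z → x + h ≤ z) :
    ∑ x ∈ s, (1 : ℝ) / x ≤ 2 / h * (1 + Real.log J) := by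
  have hmap : ∀ x ∈ s, x / h ∈ Finset.Icc 1 J := fun x hx =>
    Finset.mem_Icc.2 ⟨Nat.div_pos (hlo x hx) hh, (Nat.div_le_self _ _).trans (hhi x hx)⟩
  rw [← Finset.sum_fiberwise_of_maps_to hmap]
  have hfib : ∀ k ∈ Finset.Icc 1 J, ∑ x ∈ s with x / h = k, (1 : ℝ) / x ≤ 2 / h * (k : ℝ)⁻¹ := by
    intro k hk
    have hk1 := (Finset.mem_Icc.1 hk).1
    have hh' : (0 : ℝ) < h := by exact_mod_cast hh
    have hk' : (0 : ℝ) < k := by exact_mod_cast hk1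
    have hcard : (s.filter (fun x => x / h = k)).card ≤ 2 := by
      by_contra! hc
      obtain ⟨x, y, z, hx, hy, hz, hxy, hxz, hyz⟩ := Finset.two_lt_card_iff.1 hc
      simp only [Finset.mem_filter] at hx hy hz
      have key : ∀ p q r, (p ∈ s ∧ p / h = k) → (q ∈ s ∧ q / h = k) → (r ∈ s ∧ r / h = k) →
          p < q → q < r → False := by
        intro p q r hp hq hr hpq hqr
        have h1 := hs p hp.1 q hq.1 r hr.1 hpq hqr
        have h2 : (p + h) / h ≤ r / h := Nat.div_le_div_right h1
        rw [Nat.add_div_right _ hh, hp.2, hr.2] at h2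
        omega
      rcases lt_or_gt_of_ne hxy with h1 | h1 <;> rcases lt_or_gt_of_ne hxz with h2 | h2 <;>
        rcases lt_or_gt_of_ne hyz with h3 | h3
      · exact key x y z hx hy hz h1 h3
      · exact key x z y hx hz hy h2 h3
      · omega
      · exact key z x y hz hx hy h2 h1
      · exact key y x z hy hx hz h1 h2
      · omega
      · exact key y z x hy hz hx h3 h2
      · exact key z y x hz hy hx h3 h1
    have hterm : ∀ x ∈ s.filter (fun x => x / h = k), (1 : ℝ) / x ≤ 1 / (h * k) := by
      intro x hx
      simp only [Finset.mem_filter] at hx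
      refine one_div_le_one_div_of_le (by positivity) ?_
      rw [← hx.2]
      exact_mod_cast Nat.mul_div_le x h
    refine (Finset.sum_le_card_nsmul _ _ _ hterm).trans ?_
    rw [nsmul_eq_mul]
    calc ((s.filter (fun x => x / h = k)).card : ℝ) * (1 / (h * k)) ≤ 2 * (1 / (h * k)) := by
          gcongr
          exact_mod_cast hcard
      _ = _ := by field_simp
  refine (Finset.sum_le_sum hfib).trans ?_
  rw [← Finset.mul_sum]
  gcongr
  have h1 := harmonic_le_one_add_log J
  rw [harmonic_eq_sum_Icc] at h1
  push_cast at h1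
  exact h1

/-- Reciprocal sum over a set growing at least geometrically with ratio `1 + δ`. -/
theorem sum_one_div_le_of_geometric_growth {δ : ℝ} (hδ : 0 < δ) (s : Finset ℕ) :
    (∀ x ∈ s, ∀ y ∈ s, x < y → (x : ℝ) * (1 + δ) ≤ y) →
    ∀ Y : ℝ, 0 < Y → (∀ x ∈ s, Y ≤ x) → ∑ x ∈ s, (1 : ℝ) / x ≤ (1 + 1 / δ) / Y := by
  induction s using Finset.induction_on_min with
  | empty =>
    intro _ Y hY _
    simp only [Finset.sum_empty]
    positivity
  | insert a s ha ih =>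
    intro hs Y hY hlo
    have haY := hlo a (Finset.mem_insert_self a s)
    have ha0 : (0 : ℝ) < a := hY.trans_le haY
    rw [Finset.sum_insert (fun h => lt_irrefl _ (ha a h))]
    have h1 := ih (fun x hx y hy => hs x (Finset.mem_insert_of_mem hx) y
      (Finset.mem_insert_of_mem hy)) (a * (1 + δ)) (by positivity) (fun x hx =>
        hs a (Finset.mem_insert_self a s) x (Finset.mem_insert_of_mem hx) (ha x hx))
    calc (1 : ℝ) / a + ∑ x ∈ s, (1 : ℝ) / x ≤ 1 / a + (1 + 1 / δ) / (a * (1 + δ)) := by gcongr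
      _ = (1 + 1 / δ) / a := by field_simp; ring
      _ ≤ _ := by gcongr

theorem IsNSol.mul_le_of_lt {N x y m n : ℕ} {w : ℝ} (hw : 62.3752 ≤ w)
    (hN : Real.log N = Real.exp w) (hx : IsNSol N x m) (hy : IsNSol N y n) (hxy : x < y)
    (hxw : 0.8 * w ≤ Real.log x) : (x : ℝ) * (1 + 0.32 * w ^ 2 / Real.exp w) ≤ y := by
  have hx2 : (2 : ℝ) ≤ x := by exact_mod_cast hx.1
  have hy3 : (3 : ℝ) ≤ y := by exact_mod_cast (show 3 ≤ y by have := hx.1; omega)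
  have hN0 : 0 < N := by
    rcases Nat.eq_zero_or_pos N with h | h
    · rw [h] at hN
      simp at hN
      exact absurd hN (Real.exp_pos w).ne
    · exact h
  have hnm : (n : ℝ) + 1 ≤ m := by exact_mod_cast hx.exponent_lt hy hxy
  have h1 := hx.pred_mul_log_le
  have h2 := hy.le_pred_mul_log hN0
  rw [hN] at h1 h2
  have hl : Real.log x ≤ Real.log y :=
    Real.log_le_log (by linarith) (by exact_mod_cast hxy.le)
  have e : (y : ℝ) / x = Real.exp (Real.log y - Real.log x) := by
    rw [Real.exp_sub, Real.exp_log (by linarith), Real.exp_log (by linarith)]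
  have h0 : 0 < Real.exp w := Real.exp_pos w
  have h3 : 1 / ((y : ℝ) - 1) ≤ 1 / 2 := one_div_le_one_div_of_le (by norm_num) (by linarith)
  have h4 : 0.32 * w ^ 2 ≤ Real.exp w * (Real.log y - Real.log x) := by
    have hu : 0 < Real.log x := by linarith
    have hv : 0 < Real.log y := by linarith
    have a1 : (n : ℝ) * Real.log x * Real.log y ≤ Real.exp w * Real.log y := by
      gcongr
      refine le_trans ?_ h1
      gcongr
      linarith
    have a2 : (Real.exp w - 1 / 2) * Real.log x ≤ ((n : ℝ) - 1) * Real.log y * Real.log x := by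
      gcongr
      linarith
    have a3 : 0.64 * w ^ 2 ≤ Real.log x * Real.log y := by nlinarith
    have a4 : Real.log x ≤ Real.log x * Real.log y := by nlinarith
    nlinarith
  have h5 : 0.32 * w ^ 2 / Real.exp w ≤ Real.log y - Real.log x := by
    rw [div_le_iff₀ h0]
    linarith
  have h6 := Real.add_one_le_exp (Real.log y - Real.log x)
  rw [← e, le_div_iff₀ (by linarith)] at h6
  nlinarith

open scoped Classical in
theorem stmt16 (N x₁ m₁ : ℕ) (hN : Real.exp (Real.exp 62.3752) ≤ (N : ℝ))
    (h₁ : IsNSol N x₁ m₁) (hmin : ∀ x m : ℕ, IsNSol N x m → x₁ ≤ x) :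
    ∑ x ∈ (Finset.range (N + 1)).filter
        (fun x => x₁ < x ∧ (x : ℝ) < Real.log N ^ 3 ∧ ∃ m, IsNSol N x m),
      (1 : ℝ) / x < 3.0919 := by
  set S := (Finset.range (N + 1)).filter
    (fun x => x₁ < x ∧ (x : ℝ) < Real.log N ^ 3 ∧ ∃ m, IsNSol N x m)
  have hNpos : (0 : ℝ) < N := (Real.exp_pos _).trans_le hN
  have hE : Real.exp 62.3752 ≤ Real.log N := by
    rwa [Real.le_log_iff_exp_le hNpos]
  have hlog0 : 0 < Real.log N := (Real.exp_pos _).trans_le hE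
  obtain ⟨w, hwN⟩ : ∃ w, Real.log N = Real.exp w := ⟨_, (Real.exp_log hlog0).symm⟩
  have hw : 62.3752 ≤ w := by
    rw [hwN] at hE
    exact Real.exp_le_exp.1 hE
  have hsol : ∀ x ∈ S, ∃ m, IsNSol N x m := fun x hx => (Finset.mem_filter.1 hx).2.2.2
  have hlarge : ∀ x ∈ S, Real.exp (0.55 * w) ≤ x := by
    intro x hx
    obtain ⟨-, hlt, hcube, m, hm⟩ := Finset.mem_filter.1 hx
    refine (h₁.exp_lt_of_lt hw hwN hm hlt hcube).le.trans ?_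
    exact_mod_cast hlt.le
  have hsplit := Finset.sum_filter_add_sum_filter_not S (fun x : ℕ => 8 * w * (x : ℝ) ≤ Real.exp w)
    (fun x : ℕ => (1 : ℝ) / x)
  have hE4 := pow_four_le_exp hw
  have hE45 : Real.exp (0.45 * w) ≤ Real.exp (0.55 * w) := Real.exp_le_exp.2 (by linarith)
  have hw3 : 1 ≤ w ^ 3 := one_le_pow₀ (by linarith)
  have hE5 : 83521 * w ≤ Real.exp (0.55 * w) := by nlinarith
  have hE6 : 83521 * w ≤ Real.exp w := hE5.trans (Real.exp_le_exp.2 (by linarith))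
  have hsmall : ∑ x ∈ S.filter (fun x : ℕ => 8 * w * (x : ℝ) ≤ Real.exp w), (1 : ℝ) / x ≤ 2.1 := by
    have hfl : (⌊w⌋₊ : ℝ) ≤ w := Nat.floor_le (by linarith)
    have hfl' := Nat.lt_floor_add_one w
    have hh : 0 < ⌊w⌋₊ := Nat.floor_pos.2 (by linarith)
    have hJ := Nat.floor_le (Real.exp_pos w).le
    have hJ1 : 1 ≤ ⌊Real.exp w⌋₊ := (Nat.one_le_floor_iff _).2 (by linarith)
    refine (sum_one_div_le_of_three_spread _ hh (J := ⌊Real.exp w⌋₊) ?_ ?_ ?_).trans ?_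
    · intro x hx
      have h2 := hlarge x (Finset.mem_filter.1 hx).1
      have h3 : (⌊w⌋₊ : ℝ) ≤ x := by linarith
      exact_mod_cast h3
    · intro x hx
      refine Nat.le_floor (le_trans ?_ (Finset.mem_filter.1 hx).2)
      exact le_mul_of_one_le_left (Nat.cast_nonneg x) (by linarith)
    · intro x hx y hy z hz hxy hyz
      rw [Finset.mem_filter] at hx hy hz
      obtain ⟨a, ha⟩ := hsol x hx.1
      obtain ⟨b, hb⟩ := hsol y hy.1
      obtain ⟨c, hc⟩ := hsol z hz.1
      have h2 := ha.add_le_of_lt_of_lt hw hwN hb hc hxy hyz (hlarge x hx.1) hz.2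
      have h3 : (x : ℝ) + ⌊w⌋₊ ≤ z := by linarith
      exact_mod_cast h3
    · have h4 : Real.log ⌊Real.exp w⌋₊ ≤ w := by
        have h5 := Real.log_le_log (by exact_mod_cast hJ1) hJ
        rwa [Real.log_exp] at h5
      have hh' : (0 : ℝ) < ⌊w⌋₊ := by exact_mod_cast hh
      calc 2 / (⌊w⌋₊ : ℝ) * (1 + Real.log ⌊Real.exp w⌋₊) ≤ 2 / (⌊w⌋₊ : ℝ) * (1 + w) := by gcongr
        _ = 2 * (1 + w) / ⌊w⌋₊ := by ring
        _ ≤ 2.1 := by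
          rw [div_le_iff₀ hh']
          linarith
  have hbig : ∑ x ∈ S.filter (fun x : ℕ => ¬ 8 * w * (x : ℝ) ≤ Real.exp w), (1 : ℝ) / x ≤ 0.5 := by
    have hw0 : 0 < w := by linarith
    have hY : 0 < Real.exp w / (8 * w) := by positivity
    have hxY : ∀ x ∈ S.filter (fun x : ℕ => ¬ 8 * w * (x : ℝ) ≤ Real.exp w),
        Real.exp w / (8 * w) ≤ x := by
      intro x hx
      rw [div_le_iff₀ (by positivity)]
      linarith [not_le.1 (Finset.mem_filter.1 hx).2]
    refine (sum_one_div_le_of_geometric_growth (δ := 0.32 * w ^ 2 / Real.exp w) (by positivity) _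
      ?_ _ hY hxY).trans ?_
    · intro x hx y hy hxy
      obtain ⟨a, ha⟩ := hsol x (Finset.mem_filter.1 hx).1
      obtain ⟨b, hb⟩ := hsol y (Finset.mem_filter.1 hy).1
      refine ha.mul_le_of_lt hw hwN hb hxy ?_
      have h2 : Real.exp (0.8 * w) ≤ Real.exp w / (8 * w) := by
        rw [le_div_iff₀ (by positivity)]
        have h3 : 8 * w ≤ Real.exp (0.2 * w) := by linarith [exp_seven_mul_le_exp (0.2 * w)]
        calc Real.exp (0.8 * w) * (8 * w) ≤ Real.exp (0.8 * w) * Real.exp (0.2 * w) := by gcongr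
          _ = Real.exp w := by rw [← Real.exp_add]; ring_nf
      have h4 := Real.log_le_log (Real.exp_pos _) (h2.trans (hxY x hx))
      rwa [Real.log_exp] at h4
    · have h2 : (1 + 1 / (0.32 * w ^ 2 / Real.exp w)) / (Real.exp w / (8 * w)) =
          8 * w / Real.exp w + 25 / w := by
        field_simp
        ring
      have h3 : 8 * w / Real.exp w ≤ 0.001 := by
        rw [div_le_iff₀ (Real.exp_pos w)]
        linarith
      have h4 : 25 / w ≤ 0.41 := by
        rw [div_le_iff₀ hw0]
        linarith
      rw [h2]
      linarith
  rw [← hsplit]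
  linarith
end

section
/- Let N ≥ 10^{100000} be an integer. Then the sum of 1/x over all N-solutions (x, m) with x ≥ (log N)^3 is at most 1/(3·(log N)²·log log N); in particular this sum is less than 10^{−5}. -/
/-- For fixed `m`, an `N`-solution `(x, m)` is determined by `m`. -/
lemma IsNSol.base_unique {N x y m : ℕ} (hx : IsNSol N x m) (hy : IsNSol N y m) : x = y := by
  have lt_false {a b : ℕ} (ha : IsNSol N a m) (hb : IsNSol N b m) (hab : a < b) : False := by
    have hlt : ∑ i ∈ Finset.range m, a ^ i < ∑ i ∈ Finset.range m, b ^ i := by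
      refine Finset.sum_lt_sum (fun i _ => Nat.pow_le_pow_left hab.le i) ⟨1, ?_, by simpa using hab⟩
      have := ha.2.1
      exact Finset.mem_range.2 (by omega)
    have := ha.2.2
    have := hb.2.2
    omega
  rcases lt_trichotomy x y with h | h | h
  · exact (lt_false hx hy h).elim
  · exact h
  · exact (lt_false hy hx h).elim

lemma IsNSol.mul_log_le {N x m : ℕ} (h : IsNSol N x m) :
    ((m - 1 : ℕ) : ℝ) * Real.log x ≤ Real.log N := by
  obtain ⟨hx, hm, hs⟩ := h
  have hle : x ^ (m - 1) ≤ N := by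
    rw [← hs]
    exact Finset.single_le_sum (f := fun i => x ^ i) (fun i _ => Nat.zero_le _)
      (Finset.mem_range.2 (by omega))
  rw [← Real.log_pow]
  refine Real.log_le_log ?_ (by exact_mod_cast hle)
  have : (0 : ℝ) < x := by exact_mod_cast (by omega : 0 < x)
  positivity

/-- A set of bases `x ≥ (log N)^3` of `N`-solutions has at most `log N / (3 log log N)` elements. -/
lemma card_le_of_isNSol {N : ℕ} (hN : 1 < Real.log N) (S : Finset ℕ)
    (hS : ∀ x ∈ S, Real.log N ^ 3 ≤ (x : ℝ) ∧ ∃ m, IsNSol N x m) :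
    (S.card : ℝ) ≤ Real.log N / (3 * Real.log (Real.log N)) := by
  have hl : 0 < Real.log (Real.log N) := Real.log_pos hN
  choose! f hf using fun x hx => (hS x hx).2
  have hcard : S.card ≤ (Finset.Icc 1 ⌊Real.log N / (3 * Real.log (Real.log N))⌋₊).card := by
    refine Finset.card_le_card_of_injOn (fun x => f x - 1) (fun x hx => ?_) (fun x hx y hy hxy => ?_)
    · have hm := (hf x hx).2.1
      refine Finset.mem_coe.2 (Finset.mem_Icc.2 ⟨Nat.le_sub_one_of_lt hm, Nat.le_floor ?_⟩)
      rw [le_div_iff₀ (by positivity)]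
      refine le_trans ?_ (hf x hx).mul_log_le
      gcongr
      calc 3 * Real.log (Real.log N) = Real.log (Real.log N ^ 3) := by
            rw [Real.log_pow]; norm_num
        _ ≤ Real.log x := Real.log_le_log (by positivity) (hS x hx).1
    · have hmx := (hf x hx).2.1
      have hmy := (hf y hy).2.1
      have hfxy : f x = f y := by
        simp only at hxy
        omega
      exact (hf x hx).base_unique (hfxy ▸ hf y hy)
  rw [Nat.card_Icc, Nat.add_sub_cancel] at hcard
  exact (Nat.cast_le.2 hcard).trans (Nat.floor_le (by positivity))

lemma sum_inv_le_of_isNSol {N : ℕ} (hN : 1 < Real.log N) (S : Finset ℕ)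
    (hS : ∀ x ∈ S, Real.log N ^ 3 ≤ (x : ℝ) ∧ ∃ m, IsNSol N x m) :
    ∑ x ∈ S, (1 : ℝ) / x ≤ 1 / (3 * Real.log N ^ 2 * Real.log (Real.log N)) := by
  have hl : 0 < Real.log (Real.log N) := Real.log_pos hN
  have hL : 0 < Real.log N := by linarith
  calc ∑ x ∈ S, (1 : ℝ) / x ≤ S.card • (1 / Real.log N ^ 3) :=
        Finset.sum_le_card_nsmul _ _ _ fun x hx =>
          one_div_le_one_div_of_le (by positivity) (hS x hx).1
    _ = S.card * (1 / Real.log N ^ 3) := nsmul_eq_mul _ _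
    _ ≤ Real.log N / (3 * Real.log (Real.log N)) * (1 / Real.log N ^ 3) := by
        gcongr
        exact card_le_of_isNSol hN S hS
    _ = 1 / (3 * Real.log N ^ 2 * Real.log (Real.log N)) := by
        field_simp

lemma natCast_le_log_of_ten_pow_le {N k : ℕ} (h : 10 ^ k ≤ N) : (k : ℝ) ≤ Real.log N := by
  have h10 : 1 ≤ Real.log 10 := by
    rw [Real.le_log_iff_exp_le (by norm_num)]
    linarith [Real.exp_one_lt_d9]
  calc (k : ℝ) ≤ k * Real.log 10 := le_mul_of_one_le_right (Nat.cast_nonneg k) h10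
    _ = Real.log (10 ^ k) := (Real.log_pow _ _).symm
    _ ≤ Real.log N := Real.log_le_log (by positivity) (by exact_mod_cast h)

open scoped Classical in
theorem stmt17 (N : ℕ) (hN : 10 ^ 100000 ≤ N) :
    (∑ x ∈ (Finset.range (N + 1)).filter
        (fun x : ℕ => Real.log N ^ 3 ≤ (x : ℝ) ∧ ∃ m, IsNSol N x m), (1 : ℝ) / x)
      ≤ 1 / (3 * Real.log N ^ 2 * Real.log (Real.log N)) ∧
    (∑ x ∈ (Finset.range (N + 1)).filter
        (fun x : ℕ => Real.log N ^ 3 ≤ (x : ℝ) ∧ ∃ m, IsNSol N x m), (1 : ℝ) / x)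
      < 1e-5 := by
  have hL : (100000 : ℝ) ≤ Real.log N := by
    exact_mod_cast natCast_le_log_of_ten_pow_le hN
  clear hN
  have hsum := sum_inv_le_of_isNSol (N := N) (by linarith) ((Finset.range (N + 1)).filter
    (fun x : ℕ => Real.log N ^ 3 ≤ (x : ℝ) ∧ ∃ m, IsNSol N x m))
    fun x hx => (Finset.mem_filter.1 hx).2
  refine ⟨hsum, hsum.trans_lt ?_⟩
  have hl : 1 ≤ Real.log (Real.log N) := by
    rw [Real.le_log_iff_exp_le (by linarith)]
    linarith [Real.exp_one_lt_d9]
  calc 1 / (3 * Real.log N ^ 2 * Real.log (Real.log N)) ≤ 1 / (3 * 100000 ^ 2 * 1) := by gcongr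
    _ < 1e-5 := by norm_num
end
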